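/- arXiv:2003.06178 — 3 statements merged into one kernel-verified Lean document; each statement's English description precedes it below -/
import Mathlib

section
/- Let D be a digraph, X, Y vertex sets, and X' ⊆ X a subset that is (X,Y)-finitely extendable in D. Suppose for some finite vertex set U ⊆ V(D)\X', the set X' is joinable to Y\U in D−U. Then U can be extended by at most |U| many new vertices from X\X' to a set W such that X' (equivalently X'\W) is (X\W, Y\W)-finitely extendable in D−W. -/
/-!  Common framework: digraphs as edge sets on a vertex type, directed paths,
path-systems, separations, flames and largeness. -/

universe u

variable {V : Type u}

/-- A directed path in the digraph on `V` with edge set `E`, given by its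
(nonempty, repetition-free) list of vertices `start :: rest`. -/
structure Dipath (E : Set (V × V)) : Type u where
  start : V
  rest : List V
  chain : List.Chain (fun a b => (a, b) ∈ E) start rest
  nodup : (start :: rest).Nodup

namespace Dipath

variable {E : Set (V × V)}

/-- The list of vertices of the path. -/
def verts (p : Dipath E) : List V := p.start :: p.rest

/-- The terminal vertex of the path. -/
def last (p : Dipath E) : V := (p.start :: p.rest).getLast (List.cons_ne_nil _ _)

/-- The set of vertices of the path. -/
def support (p : Dipath E) : Set V := {v | v ∈ p.verts}

/-- The internal vertices of the path (all vertices except the first and the last). -/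
def internal (p : Dipath E) : Set V := {v | v ∈ p.rest.dropLast}

/-- The list of (directed) edges of the path. -/
def edges (p : Dipath E) : List (V × V) := p.verts.zip p.rest

/-- The set of edges of the path. -/
def edgeSet (p : Dipath E) : Set (V × V) := {e | e ∈ p.edges}

/-- The last edge of the path, if the path has at least one edge. -/
def lastEdge? (p : Dipath E) : Option (V × V) := p.edges.getLast?

end Dipath

section Defs

variable (E : Set (V × V))

/-- The set of ingoing edges of `v`. -/
def inEdges (v : V) : Set (V × V) := {e ∈ E | e.2 = v}

/-- The set of initial vertices of a set of paths. -/
def initVerts {E : Set (V × V)} (P : Set (Dipath E)) : Set V := Dipath.start '' P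

/-- The set of terminal vertices of a set of paths. -/
def termVerts {E : Set (V × V)} (P : Set (Dipath E)) : Set V := Dipath.last '' P

/-- The set of terminal edges of a set of paths. -/
def termEdges {E : Set (V × V)} (P : Set (Dipath E)) : Set (V × V) :=
  {e | ∃ p ∈ P, p.lastEdge? = some e}

/-- An `(r,v)`-path-system: a set of pairwise internally disjoint directed
paths from `r` to `v`. -/
def IsRVSystem (r v : V) (P : Set (Dipath E)) : Prop :=
  (∀ p ∈ P, p.start = r ∧ p.last = v) ∧
    P.Pairwise fun p q => p.support ∩ q.support ⊆ {r, v}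

/-- An `(r,v)`-separation: a set of vertices avoiding `r` and `v` and meeting
every directed path from `r` to `v`. -/
def IsSeparation (r v : V) (S : Set V) : Prop :=
  r ∉ S ∧ v ∉ S ∧ ∀ p : Dipath E, p.start = r → p.last = v → (p.support ∩ S).Nonempty

/-- A set of paths `P` and a vertex set `S` are orthogonal:  every path of `P`
meets `S` in exactly one vertex and every vertex of `S` lies on a path of `P`. -/
def Orthogonal {E : Set (V × V)} (P : Set (Dipath E)) (S : Set V) : Prop :=
  (∀ p ∈ P, ∃! x, x ∈ p.support ∩ S) ∧ ∀ x ∈ S, ∃ p ∈ P, x ∈ p.support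

/-- An Erdős–Menger `(r,v)`-path-system: one orthogonal to some `(r,v)`-separation. -/
def IsEMSystem (r v : V) (P : Set (Dipath E)) : Prop :=
  IsRVSystem E r v P ∧ ∃ S, IsSeparation E r v S ∧ Orthogonal P S

/-- An Erdős–Menger `(r,v)`-separation: one orthogonal to some `(r,v)`-path-system. -/
def IsEMSeparation (r v : V) (S : Set V) : Prop :=
  IsSeparation E r v S ∧ ∃ P : Set (Dipath E), IsRVSystem E r v P ∧ Orthogonal P S

/-- `𝒢_E(v)` (with root `r`): the collection of edge sets `I` that arise as the set of
terminal edges of an internally disjoint `(r,v)`-path-system in `E`. -/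
def GSet (r v : V) : Set (Set (V × V)) :=
  {I | ∃ P : Set (Dipath E), IsRVSystem E r v P ∧ termEdges P = I}

/-- A vertex-flame (with root `r`): for every `v ≠ r`, the whole in-edge set of `v`
is the terminal edge set of an internally disjoint `(r,v)`-path-system. -/
def IsFlame (r : V) : Prop := ∀ v, v ≠ r → inEdges E v ∈ GSet E r v

/-- `L` is `v`-large with respect to the digraph `E` rooted at `r`: `L` contains `rv`
whenever `E` does, and some Erdős–Menger `(r,v)`-path-system of `E - rv` lies in `L`. -/
def VLarge (r : V) (L : Set (V × V)) (v : V) : Prop :=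
  ((r, v) ∈ E → (r, v) ∈ L) ∧
    ∃ P : Set (Dipath (E \ {(r, v)})),
      IsEMSystem (E \ {(r, v)}) r v P ∧ ∀ p ∈ P, p.edgeSet ⊆ L

/-- `L` is large with respect to the digraph `E` rooted at `r`. -/
def Large (r : V) (L : Set (V × V)) : Prop := ∀ v, v ≠ r → VLarge E r L v

/-- An `(X,Y)`-path: from `X` to `Y`, internally disjoint from `X ∪ Y`. -/
def IsXYPath (X Y : Set V) (p : Dipath E) : Prop :=
  p.start ∈ X ∧ p.last ∈ Y ∧ ∀ w ∈ p.internal, w ∉ X ∪ Y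

/-- An `(X,Y)`-path-system: pairwise disjoint `(X,Y)`-paths. -/
def IsXYSystem (X Y : Set V) (P : Set (Dipath E)) : Prop :=
  (∀ p ∈ P, IsXYPath E X Y p) ∧ P.Pairwise fun p q => Disjoint p.support q.support

/-- `X` is joinable to `Y`: some `(X,Y)`-path-system covers `X` with its initial vertices. -/
def Joinable (X Y : Set V) : Prop :=
  ∃ P : Set (Dipath E), IsXYSystem E X Y P ∧ initVerts P = X

/-- `X` is incompressible to `Y`: `X` is joinable to `Y` and every witnessing
path-system covers `Y` with its terminal vertices. -/
def Incompressible (X Y : Set V) : Prop :=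
  Joinable E X Y ∧
    ∀ P : Set (Dipath E), IsXYSystem E X Y P → initVerts P = X → termVerts P = Y

/-- An `(X,Y)`-separation: a vertex set meeting every `(X,Y)`-path. -/
def IsXYSeparation (X Y : Set V) (S : Set V) : Prop :=
  ∀ p : Dipath E, IsXYPath E X Y p → (p.support ∩ S).Nonempty

/-- An Erdős–Menger `(X,Y)`-separation: one orthogonal to some `(X,Y)`-path-system. -/
def IsEMXYSeparation (X Y : Set V) (S : Set V) : Prop :=
  IsXYSeparation E X Y S ∧ ∃ P : Set (Dipath E), IsXYSystem E X Y P ∧ Orthogonal P S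

/-- `X'` is `(X,Y)`-finitely extendable: every `O` with `X' ⊆ O ⊆ X` and `O \ X'`
finite is joinable to `Y`. -/
def FinExtendable (X Y X' : Set V) : Prop :=
  X' ⊆ X ∧ ∀ O, X' ⊆ O → O ⊆ X → (O \ X').Finite → Joinable E O Y

/-- `S` separates the vertex `y` from `r`:  every directed path from `r` to `y` meets `S`. -/
def SeparatesFrom (r : V) (S : Set V) (y : V) : Prop :=
  ∀ p : Dipath E, p.start = r → p.last = y → (p.support ∩ S).Nonempty

/-- An `(X,y)`-path: from a vertex of `X` to `y`, internally disjoint from `X`. -/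
def IsXyPath (X : Set V) (y : V) (p : Dipath E) : Prop :=
  p.start ∈ X ∧ p.last = y ∧ ∀ w ∈ p.internal, w ∉ X

/-- An `(X,y)`-path-system: `(X,y)`-paths, pairwise disjoint except possibly at `y`. -/
def IsXySystem (X : Set V) (y : V) (P : Set (Dipath E)) : Prop :=
  (∀ p ∈ P, IsXyPath E X y p) ∧ P.Pairwise fun p q => p.support ∩ q.support ⊆ {y}

/-- An `(r,S)`-path: from `r` to a vertex of `S`, internally disjoint from `S`. -/
def IsRSPath (r : V) (S : Set V) (p : Dipath E) : Prop :=
  p.start = r ∧ p.last ∈ S ∧ ∀ w ∈ p.internal, w ∉ S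

/-- An `(r,S)`-path-system: `(r,S)`-paths, pairwise disjoint apart from `r`. -/
def IsRSSystem (r : V) (S : Set V) (P : Set (Dipath E)) : Prop :=
  (∀ p ∈ P, IsRSPath E r S p) ∧ P.Pairwise fun p q => p.support ∩ q.support ⊆ {r}

/-- `E` is a `G`-quasi-flame (with root `r`): for every `v ≠ r`, every set `I` of
ingoing edges of `v` with `I \ inEdges G v` finite lies in `𝒢_E(v)`. -/
def QuasiFlame (r : V) (G : Set (V × V)) : Prop :=
  ∀ v, v ≠ r → ∀ I, I ⊆ inEdges E v → (I \ inEdges G v).Finite → I ∈ GSet E r v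

/-- The local connectivity `κ_E(r,v)`: the maximum size of an internally disjoint
`(r,v)`-path-system. -/
noncomputable def kappa (r v : V) : ℕ :=
  sSup {n | ∃ P : Set (Dipath E), IsRVSystem E r v P ∧ P.Finite ∧ P.ncard = n}

end Defs

open Classical in
/-- Position of a vertex in a list. -/
noncomputable def ix {V : Type u} (l : List V) (v : V) : ℕ := l.idxOf v

def IsP {V : Type u} (E : Set (V × V)) (Y : Set V) (a : V) (l : List V) : Prop :=
  l.head? = some a ∧ l.IsChain (fun a b => (a, b) ∈ E) ∧ l.Nodup ∧ ∃ y ∈ Y, l.getLast? = some y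

def LkBy {V : Type u} (E : Set (V × V)) (Y O : Set V) (f : V → List V) : Prop :=
  (∀ a ∈ O, IsP E Y a (f a)) ∧ ∀ a ∈ O, ∀ b ∈ O, ∀ v, v ∈ f a → v ∈ f b → a = b

def Lk {V : Type u} (E : Set (V × V)) (Y O : Set V) : Prop := ∃ f, LkBy E Y O f

theorem ix_inj {V : Type u} {l : List V} {v w : V} (hv : v ∈ l) (h : ix l v = ix l w) : v = w := by
  classical
  unfold ix at h
  exact (List.idxOf_inj hv).1 (by convert h)

theorem IsP.start_mem {V : Type u} {E : Set (V × V)} {Y : Set V} {a : V} {l : List V}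
    (h : IsP E Y a l) : a ∈ l := List.mem_of_mem_head? h.1

theorem chain_in {V : Type u} {E : Set (V × V)} {a : V} {l : List V}
    (h : (a :: l).IsChain (fun a b => (a, b) ∈ E)) : ∀ v ∈ l, ∃ u, (u, v) ∈ E := by
  induction l generalizing a with
  | nil => simp
  | cons b l ih =>
    rw [List.isChain_cons_cons] at h
    intro v hv
    rcases List.mem_cons.1 hv with rfl | hv
    · exact ⟨_, h.1⟩
    · exact ih h.2 v hv

theorem chain_out {V : Type u} {E : Set (V × V)} {a : V} {l : List V}
    (h : (a :: l).IsChain (fun a b => (a, b) ∈ E)) : ∀ v ∈ l.dropLast, ∃ u, (v, u) ∈ E := by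
  induction l generalizing a with
  | nil => simp
  | cons b l ih =>
    rw [List.isChain_cons_cons] at h
    intro v hv
    cases l with
    | nil => simp at hv
    | cons c l =>
      rw [List.dropLast_cons_cons] at hv
      rcases List.mem_cons.1 hv with rfl | hv
      · exact ⟨_, (List.isChain_cons_cons.1 h.2).1⟩
      · exact ih h.2 v hv

theorem IsP.eq_start {V : Type u} {E : Set (V × V)} {X Y : Set V} {a : V} {l : List V}
    (hX : ∀ e ∈ E, e.2 ∉ X) (h : IsP E Y a l) {v : V} (hv : v ∈ l) (hvX : v ∈ X) : v = a := by
  obtain ⟨h1, h2, -, -⟩ := h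
  cases l with
  | nil => simp at hv
  | cons b l =>
    simp at h1
    subst h1
    rcases List.mem_cons.1 hv with rfl | hv
    · rfl
    · obtain ⟨u, hu⟩ := chain_in h2 v hv
      exact absurd hvX (hX _ hu)

theorem IsP.restrict {V : Type u} {E : Set (V × V)} {Y W : Set V} {a : V} {l : List V}
    (h : IsP E Y a l) (hW : ∀ v ∈ l, v ∉ W) :
    IsP {e ∈ E | e.1 ∉ W ∧ e.2 ∉ W} (Y \ W) a l := by
  obtain ⟨h1, h2, h3, y, hy, h4⟩ := h
  refine ⟨h1, ?_, h3, y, ⟨hy, hW _ (List.mem_of_mem_getLast? h4)⟩, h4⟩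
  clear h1 h3 h4
  induction l with
  | nil => simp
  | cons b l ih =>
    cases l with
    | nil => simp
    | cons c l =>
      rw [List.isChain_cons_cons] at h2 ⊢
      exact ⟨⟨h2.1, hW _ (by simp), hW _ (by simp)⟩,
        ih (fun v hv => hW v (List.mem_cons_of_mem _ hv)) h2.2⟩

theorem IsP.mono {V : Type u} {E E' : Set (V × V)} {Y Y' : Set V} {a : V} {l : List V}
    (h : IsP E Y a l) (hE : E ⊆ E') (hY : Y ⊆ Y') : IsP E' Y' a l := by
  obtain ⟨h1, h2, h3, y, hy, h4⟩ := h
  exact ⟨h1, h2.imp (fun _ _ h => hE h), h3, y, hY hy, h4⟩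

theorem Lk.mono {V : Type u} {E : Set (V × V)} {Y O O' : Set V} (h : Lk E Y O) (hO : O' ⊆ O) :
    Lk E Y O' := by
  obtain ⟨f, h1, h2⟩ := h
  exact ⟨f, fun a ha => h1 a (hO ha), fun a ha b hb => h2 a (hO ha) b (hO hb)⟩

theorem Joinable.lk {V : Type u} {E : Set (V × V)} {Y O : Set V} (h : Joinable E O Y) :
    Lk E Y O := by
  obtain ⟨P, ⟨hP, hd⟩, hO⟩ := h
  have : ∀ a : V, ∃ p : List V, a ∈ O → ∃ d ∈ P, d.start = a ∧ d.verts = p := by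
    intro a
    by_cases ha : a ∈ O
    · rw [← hO] at ha
      obtain ⟨d, hd, rfl⟩ := ha
      exact ⟨_, fun _ => ⟨d, hd, rfl, rfl⟩⟩
    · exact ⟨[], fun h => absurd h ha⟩
  choose f hf using this
  refine ⟨f, ?_, ?_⟩
  · intro a ha
    obtain ⟨d, hd, rfl, hv⟩ := hf a ha
    rw [← hv]
    refine ⟨rfl, d.chain, d.nodup, d.last, (hP d hd).2.1, ?_⟩
    exact List.getLast?_eq_some_getLast _
  · intro a ha b hb v hva hvb
    obtain ⟨d, hd1, rfl, hv⟩ := hf a ha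
    obtain ⟨d', hd', rfl, hv'⟩ := hf b hb
    by_contra hne
    have hne' : d ≠ d' := fun h => hne (by rw [h])
    rw [← hv] at hva
    rw [← hv'] at hvb
    exact Set.disjoint_left.1 (hd hd1 hd' hne') hva hvb

theorem Lk.joinable {V : Type u} {E : Set (V × V)} {X Y O : Set V}
    (hX : ∀ e ∈ E, e.2 ∉ X) (hY : ∀ e ∈ E, e.1 ∉ Y) (hO : O ⊆ X) (h : Lk E Y O) :
    Joinable E O Y := by
  obtain ⟨f, h1, h2⟩ := h
  refine ⟨{d | d.start ∈ O ∧ d.verts = f d.start}, ⟨?_, ?_⟩, ?_⟩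
  · rintro d ⟨hd, hv⟩
    refine ⟨hd, ?_, ?_⟩
    · obtain ⟨-, -, -, y, hy, h4⟩ := h1 _ hd
      rw [← hv] at h4
      have : d.verts.getLast? = some d.last := List.getLast?_eq_some_getLast _
      rw [this] at h4
      rwa [Option.some.inj h4]
    · intro w hw hw'
      rcases hw' with hw' | hw'
      · obtain ⟨u, hu⟩ := chain_in d.chain w (List.dropLast_subset _ hw)
        exact hX _ hu (hO hw')
      · obtain ⟨u, hu⟩ := chain_out d.chain w hw
        exact hY _ hu hw'
  · rintro d ⟨hd, hv⟩ d' ⟨hd', hv'⟩ hne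
    refine Set.disjoint_left.2 fun w hw hw' => hne ?_
    have e : d.start = d'.start :=
      h2 _ hd _ hd' w (by rw [← hv]; exact hw) (by rw [← hv']; exact hw')
    rw [e, ← hv'] at hv
    cases d; cases d'
    simp only [Dipath.verts, List.cons.injEq] at hv
    obtain ⟨rfl, rfl⟩ := hv
    rfl
  · ext a
    constructor
    · rintro ⟨d, hd, rfl⟩
      exact hd.1
    · intro ha
      obtain ⟨g1, g2, g3, -⟩ := h1 a ha
      have : ∃ t, f a = a :: t := by
        cases hfa : f a with
        | nil => rw [hfa] at g1; simp at g1
        | cons b t => rw [hfa] at g1; simp at g1; exact ⟨t, by rw [g1]⟩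
      obtain ⟨t, ht⟩ := this
      rw [ht] at g2 g3
      exact ⟨⟨a, t, g2, g3⟩, ⟨ha, ht.symm⟩, rfl⟩

/-- Concatenating an initial segment of one path and a final segment of another. -/
theorem splice {V : Type u} {E : Set (V × V)} {Y : Set V} {a b v : V} {l m : List V}
    (hl : IsP E Y a l) (hm : IsP E Y b m) (hvl : v ∈ l) (hvm : v ∈ m)
    (hd : ∀ w, w ∈ l → w ∈ m → ix l w < ix l v → ix m v ≤ ix m w → False) :
    ∃ k, IsP E Y a k ∧ ∀ w ∈ k, (w ∈ l ∧ ix l w < ix l v) ∨ (w ∈ m ∧ ix m v ≤ ix m w) := by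
  classical
  obtain ⟨l1, l2, rfl⟩ := List.append_of_mem hvl
  obtain ⟨m1, m2, rfl⟩ := List.append_of_mem hvm
  obtain ⟨a1, a2, a3, -⟩ := hl
  obtain ⟨b1, b2, b3, y, hy, b4⟩ := hm
  have hA : ∀ w ∈ l1, ix (l1 ++ v :: l2) w < ix (l1 ++ v :: l2) v := by
    intro w hw
    have hv : v ∉ l1 := fun h => (List.nodup_append.1 a3).2.2 v h v (by simp) rfl
    unfold ix
    rw [List.idxOf_append_of_mem hw, List.idxOf_append_of_notMem hv]
    have := List.idxOf_lt_length_of_mem hw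
    omega
  have hB : ∀ w ∈ v :: m2, ix (m1 ++ v :: m2) v ≤ ix (m1 ++ v :: m2) w := by
    intro w hw
    have hv : v ∉ m1 := fun h => (List.nodup_append.1 b3).2.2 v h v (by simp) rfl
    have hw' : w ∉ m1 := fun h => (List.nodup_append.1 b3).2.2 w h w hw rfl
    unfold ix
    rw [List.idxOf_append_of_notMem hw', List.idxOf_append_of_notMem hv]
    simp
  refine ⟨l1 ++ v :: m2, ⟨?_, ?_, ?_, y, hy, ?_⟩, ?_⟩
  · cases l1 <;> simpa using a1
  · rw [List.isChain_append] at a2 b2 ⊢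
    refine ⟨a2.1, b2.2.1, ?_⟩
    simpa using a2.2.2
  · rw [List.nodup_append] at a3 b3 ⊢
    refine ⟨a3.1, b3.2.1, ?_⟩
    rintro w hw w' hw' rfl
    exact hd w (by simp [hw]) (List.mem_append_right _ hw') (hA w hw) (hB w hw')
  · rw [List.getLast?_append] at b4 ⊢
    simpa using b4
  · intro w hw
    rcases List.mem_append.1 hw with hw | hw
    · exact Or.inl ⟨by simp [hw], hA w hw⟩
    · exact Or.inr ⟨List.mem_append_right _ hw, hB w hw⟩

section GS

/-- `v` is proposed by `a` relative to the rejected set `R`. -/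
def Prp {V : Type u} (A J : Set V) (p q : V → List V) (R : Set V) (a v : V) : Prop :=
  a ∈ A ∧ v ∈ p a ∧ ∀ u ∈ p a, ix (p a) u < ix (p a) v → (∃ j ∈ J, u ∈ q j) → u ∈ R

def Phi {V : Type u} (A J : Set V) (p q : V → List V) (R : Set V) : Set V :=
  {v | ∃ a b w, ∃ j ∈ J, Prp A J p q R a v ∧ Prp A J p q R b w ∧ v ∈ q j ∧ w ∈ q j ∧
    ix (q j) v < ix (q j) w}

variable {V : Type u} {A J : Set V} {p q : V → List V}

theorem Prp.mono {R R' : Set V} (h : R ⊆ R') {a v : V} (hp : Prp A J p q R a v) :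
    Prp A J p q R' a v :=
  ⟨hp.1, hp.2.1, fun u hu h1 h2 => h (hp.2.2 u hu h1 h2)⟩

theorem Phi_mono {R R' : Set V} (h : R ⊆ R') : Phi A J p q R ⊆ Phi A J p q R' := by
  rintro v ⟨a, b, w, j, hj, h1, h2, h3⟩
  exact ⟨a, b, w, j, hj, h1.mono h, h2.mono h, h3⟩

/-- The rejected vertices. -/
def Rinf (A J : Set V) (p q : V → List V) : Set V :=
  {v | ∃ R : Set V, R.Finite ∧ R ⊆ Phi A J p q R ∧ v ∈ R}

theorem Rinf_finite_cover (S : Set V) (hS : S.Finite) (h : S ⊆ Rinf A J p q) :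
    ∃ R : Set V, R.Finite ∧ R ⊆ Phi A J p q R ∧ S ⊆ R := by
  induction S, hS using Set.Finite.induction_on with
  | empty => exact ⟨∅, Set.finite_empty, by simp, by simp⟩
  | @insert a S _ _ ih =>
    obtain ⟨R, h1, h2, h3⟩ := ih (fun x hx => h (Set.mem_insert_of_mem _ hx))
    obtain ⟨R', h1', h2', h3'⟩ := h (Set.mem_insert a S)
    refine ⟨R ∪ R', h1.union h1', ?_, ?_⟩
    · exact Set.union_subset (h2.trans (Phi_mono Set.subset_union_left))
        (h2'.trans (Phi_mono Set.subset_union_right))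
    · exact Set.insert_subset (Or.inr h3') (h3.trans Set.subset_union_left)

theorem Prp_finite {a v b w : V} (h : Prp A J p q (Rinf A J p q) a v)
    (h' : Prp A J p q (Rinf A J p q) b w) :
    ∃ R : Set V, R.Finite ∧ R ⊆ Phi A J p q R ∧ Prp A J p q R a v ∧ Prp A J p q R b w := by
  obtain ⟨R, h1, h2, h3⟩ := Rinf_finite_cover (A := A) (J := J) (p := p) (q := q)
    ({u | u ∈ p a ++ p b} ∩ Rinf A J p q)
    ((List.finite_toSet (p a ++ p b)).inter_of_left _) Set.inter_subset_right
  refine ⟨R, h1, h2, ⟨h.1, h.2.1, ?_⟩, ⟨h'.1, h'.2.1, ?_⟩⟩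
  · intro u hu h4 h5
    exact h3 ⟨List.mem_append_left _ hu, h.2.2 u hu h4 h5⟩
  · intro u hu h4 h5
    exact h3 ⟨List.mem_append_right _ hu, h'.2.2 u hu h4 h5⟩

theorem Rinf_closed : Phi A J p q (Rinf A J p q) ⊆ Rinf A J p q := by
  rintro v ⟨a, b, w, j, hj, h1, h2, h3⟩
  obtain ⟨R, g1, g2, g3, g4⟩ := Prp_finite h1 h2
  refine ⟨insert v R, g1.insert v, ?_, Set.mem_insert _ _⟩
  have hs : R ⊆ insert v R := Set.subset_insert _ _
  refine Set.insert_subset ?_ (g2.trans (Phi_mono hs))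
  exact ⟨a, b, w, j, hj, g3.mono hs, g4.mono hs, h3⟩

/-- counting argument -/
theorem count {I : Set V} {s j1 j2 v1 v2 a1 a2 : V} {R : Set V} (hR : R.Finite)
    (hRP : R ⊆ Phi (insert s (I ∩ J)) J p q R) (hs : s ∉ J)
    (hpd : ∀ a ∈ insert s (I ∩ J), ∀ b ∈ insert s (I ∩ J), ∀ v, v ∈ p a → v ∈ p b → a = b)
    (hqd : ∀ a ∈ J, ∀ b ∈ J, ∀ v, v ∈ q a → v ∈ q b → a = b)
    (hp0 : ∀ a ∈ I ∩ J, a ∈ p a ∧ a ∈ q a ∧ ∀ v ∈ p a, v ≠ a → ix (p a) a < ix (p a) v)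
    (hj1 : j1 ∈ J \ I) (hj2 : j2 ∈ J \ I) (hv1 : v1 ∈ q j1) (hv2 : v2 ∈ q j2)
    (h1 : Prp (insert s (I ∩ J)) J p q R a1 v1) (h2 : Prp (insert s (I ∩ J)) J p q R a2 v2) :
    j1 = j2 := by
  classical
  by_contra hne
  -- touched indices
  have hTfin : {j | j ∈ J ∧ ∃ v ∈ R, v ∈ q j}.Finite := by
    have : ∀ v : V, ∃ j, ∀ j' ∈ J, v ∈ q j' → j' = j := by
      intro v
      by_cases h : ∃ j ∈ J, v ∈ q j
      · obtain ⟨j, hj, hv⟩ := h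
        exact ⟨j, fun j' hj' hv' => hqd _ hj' _ hj v hv' hv⟩
      · exact ⟨v, fun j' hj' hv' => absurd ⟨j', hj', hv'⟩ h⟩
    choose g hg using this
    refine (hR.image g).subset ?_
    rintro j ⟨hj, v, hv, hvq⟩
    exact ⟨v, hv, (hg v j hj hvq).symm⟩
  let T : Finset V := insert j1 (insert j2 hTfin.toFinset)
  have hTJ : ∀ j ∈ T, j ∈ J ∧ ∃ a v, v ∈ q j ∧ Prp (insert s (I ∩ J)) J p q R a v := by
    intro j hj
    simp only [T, Finset.mem_insert, Set.Finite.mem_toFinset, Set.mem_setOf_eq] at hj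
    rcases hj with rfl | rfl | ⟨hj, v, hv, hvq⟩
    · exact ⟨hj1.1, a1, v1, hv1, h1⟩
    · exact ⟨hj2.1, a2, v2, hv2, h2⟩
    · obtain ⟨a, b, w, j', hj', h3, -⟩ := hRP hv
      exact ⟨hj, a, v, hvq, h3⟩
  have hbest : ∀ j ∈ T, ∃ a v, v ∈ q j ∧ Prp (insert s (I ∩ J)) J p q R a v ∧ v ∉ R := by
    intro j hj
    obtain ⟨hjJ, a, v, hv, hav⟩ := hTJ j hj
    have hfin : {v | v ∈ q j ∧ ∃ a, Prp (insert s (I ∩ J)) J p q R a v}.Finite :=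
      (List.finite_toSet (q j)).subset (fun x hx => hx.1)
    obtain ⟨v, ⟨hv, a, ha⟩, hmax⟩ := Set.exists_max_image _ (ix (q j)) hfin ⟨v, hv, a, hav⟩
    refine ⟨a, v, hv, ha, fun hvR => ?_⟩
    obtain ⟨a', b, w, j', hj', h3, h4, h5, h6, h7⟩ := hRP hvR
    obtain rfl := hqd _ hj' _ hjJ v h5 hv
    have := hmax w ⟨h6, b, h4⟩
    omega
  choose! ow bv hb1 hb2 hb3 using hbest
  have hmaps : ∀ j ∈ T, ow j ∈ insert s (T.filter (· ∈ I)) := by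
    intro j hj
    have hjJ := (hTJ j hj).1
    rcases (hb2 j hj).1 with h | h
    · rw [h]; exact Finset.mem_insert_self _ _
    · refine Finset.mem_insert_of_mem (Finset.mem_filter.2 ⟨?_, h.1⟩)
      obtain ⟨g1, g2, g3⟩ := hp0 _ h
      by_cases he : bv j = ow j
      · have := hb1 j hj
        rw [he] at this
        rw [hqd _ h.2 _ hjJ _ g2 this]
        exact hj
      · have : ow j ∈ R := (hb2 j hj).2.2 _ g1 (g3 _ (hb2 j hj).2.1 he) ⟨_, h.2, g2⟩
        simp only [T, Finset.mem_insert, Set.Finite.mem_toFinset, Set.mem_setOf_eq]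
        exact Or.inr (Or.inr ⟨h.2, _, this, g2⟩)
  have hinj : Set.InjOn ow (T : Set V) := by
    intro j hj j' hj' he
    have hb2' := hb2 j' hj'
    rw [← he] at hb2'
    have h3 := hb2 j hj
    have hix : bv j = bv j' := by
      rcases lt_trichotomy (ix (p (ow j)) (bv j)) (ix (p (ow j)) (bv j')) with h | h | h
      · exact absurd (hb2'.2.2 _ h3.2.1 h ⟨j, (hTJ j hj).1, hb1 j hj⟩) (hb3 j hj)
      · exact ix_inj h3.2.1 h
      · exact absurd (h3.2.2 _ hb2'.2.1 h ⟨j', (hTJ j' hj').1, hb1 j' hj'⟩) (hb3 j' hj')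
    refine hqd _ (hTJ j hj).1 _ (hTJ j' hj').1 (bv j) (hb1 j hj) ?_
    rw [hix]; exact hb1 j' hj'
  have hc := Finset.card_le_card_of_injOn ow hmaps hinj
  have hc2 := Finset.card_insert_le s (T.filter (· ∈ I))
  have hc3 := Finset.card_filter_add_card_filter_not (s := T) (· ∈ I)
  have hc4 : ({j1, j2} : Finset V) ⊆ T.filter (fun j => ¬ j ∈ I) := by
    intro x hx
    simp only [Finset.mem_insert, Finset.mem_singleton] at hx
    rcases hx with rfl | rfl
    · exact Finset.mem_filter.2 ⟨by simp [T], hj1.2⟩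
    · exact Finset.mem_filter.2 ⟨by simp [T], hj2.2⟩
  have hc5 := Finset.card_le_card hc4
  rw [Finset.card_pair hne] at hc5
  omega

end GS

theorem IsP.start_lt {V : Type u} {E : Set (V × V)} {Y : Set V} {a : V} {l : List V}
    (h : IsP E Y a l) : ∀ v ∈ l, v ≠ a → ix l a < ix l v := by
  classical
  intro v hv hne
  have h0 : ix l a = 0 := by
    obtain ⟨h1, -⟩ := h
    cases l with
    | nil => simp at hv
    | cons b l => simp at h1; subst h1; simp [ix]
  rw [h0]
  refine Nat.pos_of_ne_zero fun h1 => hne ?_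
  exact ix_inj hv (h1.trans h0.symm)

theorem augment {V : Type u} {E : Set (V × V)} {X Y I J : Set V} (hX : ∀ e ∈ E, e.2 ∉ X)
    (hI : I ⊆ X) (hIL : Lk E Y I) (hJL : Lk E Y J) {s : V} (hs : s ∈ I \ J) :
    ∃ K ⊆ J \ I, K.Subsingleton ∧ Lk E Y (insert s J \ K) := by
  classical
  obtain ⟨p, hp, hpd⟩ := hIL
  obtain ⟨q, hq, hqd⟩ := hJL
  set A := insert s (I ∩ J) with hA
  have hAI : A ⊆ I := Set.insert_subset hs.1 Set.inter_subset_left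
  set R := Rinf A J p q with hRdef
  have hcl : Phi A J p q R ⊆ R := Rinf_closed
  have hpdA : ∀ a ∈ A, ∀ b ∈ A, ∀ v, v ∈ p a → v ∈ p b → a = b :=
    fun a ha b hb => hpd a (hAI ha) b (hAI hb)
  let K : Set V := {j | j ∈ J \ I ∧ ∃ a v, v ∈ q j ∧ Prp A J p q R a v}
  refine ⟨K, fun j hj => hj.1, ?_, ?_⟩
  · rintro j ⟨hj, a, v, hv, hav⟩ j' ⟨hj', a', v', hv', hav'⟩
    obtain ⟨R', g1, g2, g3, g4⟩ := Prp_finite hav hav'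
    refine count g1 g2 hs.2 hpdA hqd ?_ hj hj' hv hv' g3 g4
    intro a ha
    exact ⟨(hp a ha.1).start_mem, (hq a ha.2).start_mem, (hp a ha.1).start_lt⟩
  -- key fact
  have key : ∀ a b v w j, j ∈ J → Prp A J p q R a v → v ∉ R → v ∈ q j → w ∈ q j →
      ix (q j) v ≤ ix (q j) w → Prp A J p q R b w → w = v := by
    intro a b v w j hj hav hvR hv hw hle hbw
    rcases hle.lt_or_eq with h | h
    · exact absurd (hcl ⟨a, b, w, j, hj, hav, hbw, hv, hw, h⟩) hvR
    · exact (ix_inj hv h).symm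
  have hnew : ∀ a, ∃ l, a ∈ A → IsP E Y a l ∧ ∀ w ∈ l, Prp A J p q R a w ∨
      ∃ v, ∃ j ∈ J, Prp A J p q R a v ∧ v ∉ R ∧ v ∈ q j ∧ w ∈ q j ∧ ix (q j) v ≤ ix (q j) w := by
    intro a
    by_cases ha : a ∈ A
    swap
    · exact ⟨[], fun h => absurd h ha⟩
    by_cases hex : ∃ v ∈ p a, (∃ j ∈ J, v ∈ q j) ∧ v ∉ R
    · have hfin : {v | v ∈ p a ∧ (∃ j ∈ J, v ∈ q j) ∧ v ∉ R}.Finite :=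
        (List.finite_toSet (p a)).subset (fun x hx => hx.1)
      obtain ⟨v, ⟨hv, ⟨j, hj, hvj⟩, hvR⟩, hmin⟩ := Set.exists_min_image _ (ix (p a)) hfin hex
      have hav : Prp A J p q R a v := by
        refine ⟨ha, hv, fun u hu hlt hu2 => ?_⟩
        by_contra huR
        have := hmin u ⟨hu, hu2, huR⟩
        omega
      have hle : ∀ w ∈ p a, ix (p a) w < ix (p a) v → Prp A J p q R a w := by
        intro w hw hlt
        exact ⟨ha, hw, fun u hu hlt' hu2 => hav.2.2 u hu (hlt'.trans hlt) hu2⟩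
      obtain ⟨l, hl, hl2⟩ := splice (hp a (hAI ha)) (hq j hj) hv hvj (by
        intro w hw hw' hlt hge
        have := key a a v w j hj hav hvR hvj hw' hge (hle w hw hlt)
        subst this
        omega)
      refine ⟨l, fun _ => ⟨hl, fun w hw => ?_⟩⟩
      rcases hl2 w hw with h | h
      · exact Or.inl (hle w h.1 h.2)
      · exact Or.inr ⟨v, j, hj, hav, hvR, hvj, h.1, h.2⟩
    · refine ⟨p a, fun _ => ⟨hp a (hAI ha), fun w hw => Or.inl ⟨ha, hw, ?_⟩⟩⟩
      intro u hu _ hu2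
      by_contra huR
      exact hex ⟨u, hu, hu2, huR⟩
  choose g hg1 using hnew
  have hO : ∀ a ∈ insert s J \ K, a ∈ A ∨
      (a ∉ A ∧ a ∈ J ∧ ∀ b v, v ∈ q a → ¬ Prp A J p q R b v) := by
    rintro a ⟨ha, haK⟩
    by_cases haA : a ∈ A
    · exact Or.inl haA
    · right
      have haJ : a ∈ J := by
        rcases ha with rfl | h
        · exact absurd (Set.mem_insert _ _) haA
        · exact h
      refine ⟨haA, haJ, fun b v hv hbv => haK ⟨⟨haJ, fun haI => haA (Or.inr ⟨haI, haJ⟩)⟩, b, v, hv, hbv⟩⟩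
  have mixed : ∀ a ∈ A, ∀ b ∈ J, (∀ c v, v ∈ q b → ¬ Prp A J p q R c v) →
      ∀ w, w ∈ g a → w ∈ q b → False := by
    intro a ha b hb hnb w hwa hwb
    rcases (hg1 a ha).2 w hwa with h | ⟨v, j, hj, h1, h2, h3, h4, h5⟩
    · exact hnb _ _ hwb h
    · obtain rfl := hqd _ hj _ hb w h4 hwb
      exact hnb _ _ h3 h1
  refine ⟨fun a => if a ∈ A then g a else q a, ?_, ?_⟩
  · intro a ha
    rcases hO a ha with h | ⟨h, h2, -⟩
    · simp only [if_pos h]; exact (hg1 a h).1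
    · simp only [if_neg h]; exact hq a h2
  · intro a ha b hb w hwa hwb
    rcases hO a ha with h | ⟨h, h2, h3⟩ <;> rcases hO b hb with h' | ⟨h', h2', h3'⟩
    · simp only [if_pos h] at hwa
      simp only [if_pos h'] at hwb
      rcases (hg1 a h).2 w hwa with k | ⟨v, j, hj, k1, k2, k3, k4, k5⟩ <;>
      rcases (hg1 b h').2 w hwb with k' | ⟨v', j', hj', k1', k2', k3', k4', k5'⟩
      · exact hpdA _ h _ h' w k.2.1 k'.2.1
      · have := key b a v' w j' hj' k1' k2' k3' k4' k5' k
        subst this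
        exact hpdA _ h _ h' w k.2.1 k1'.2.1
      · have := key a b v w j hj k1 k2 k3 k4 k5 k'
        subst this
        exact hpdA _ h _ h' w k1.2.1 k'.2.1
      · obtain rfl := hqd _ hj _ hj' w k4 k4'
        rcases le_total (ix (q j) v) (ix (q j) v') with hle | hle
        · have := key a b v v' j hj k1 k2 k3 k3' hle k1'
          subst this
          exact hpdA _ h _ h' _ k1.2.1 k1'.2.1
        · have := key b a v' v j hj k1' k2' k3' k3 hle k1
          subst this
          exact hpdA _ h _ h' _ k1.2.1 k1'.2.1
    · simp only [if_pos h] at hwa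
      simp only [if_neg h'] at hwb
      exact (mixed a h b h2' h3' w hwa hwb).elim
    · simp only [if_neg h] at hwa
      simp only [if_pos h'] at hwb
      exact (mixed b h' a h2 h3 w hwb hwa).elim
    · simp only [if_neg h] at hwa
      simp only [if_neg h'] at hwb
      exact hqd _ h2 _ h2' w hwa hwb

theorem exchange {V : Type u} {E : Set (V × V)} {X Y I : Set V} (hX : ∀ e ∈ E, e.2 ∉ X)
    (hI : I ⊆ X) (hIL : Lk E Y I) (n : ℕ) : ∀ J : Set V, Lk E Y J → (I \ J).encard = n →
    ∃ K ⊆ J \ I, K.encard ≤ n ∧ Lk E Y (I ∪ (J \ K)) := by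
  induction n with
  | zero =>
    intro J hJ h
    refine ⟨∅, by simp, by simp, ?_⟩
    have : I ⊆ J := by
      rw [← Set.diff_eq_empty, ← Set.encard_eq_zero]; exact_mod_cast h
    rw [Set.diff_empty, Set.union_eq_self_of_subset_left this]
    exact hJ
  | succ n ih =>
    intro J hJ h
    have hne : (I \ J).Nonempty := by
      rw [← Set.encard_ne_zero, h]; simp
    obtain ⟨s, hs⟩ := hne
    obtain ⟨K, hK, hKs, hL⟩ := augment hX hI hIL hJ hs
    have e : I \ (insert s J \ K) = (I \ J) \ {s} := by
      ext x
      constructor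
      · rintro ⟨h1, h2⟩
        refine ⟨⟨h1, fun hx => h2 ⟨Or.inr hx, fun hk => (hK hk).2 h1⟩⟩, fun hx => ?_⟩
        exact h2 ⟨Or.inl hx, fun hk => (hK hk).2 h1⟩
      · rintro ⟨⟨h1, h2⟩, h3⟩
        refine ⟨h1, ?_⟩
        rintro ⟨h4 | h4, -⟩
        · exact h3 h4
        · exact h2 h4
    have hc : (I \ (insert s J \ K)).encard = n := by
      rw [e]
      have := Set.encard_diff_singleton_add_one hs
      rw [h] at this
      push_cast at this
      exact WithTop.add_right_cancel ENat.one_ne_top this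
    obtain ⟨K1, hK1, hK1c, hL1⟩ := ih _ hL hc
    refine ⟨K1 ∪ K, ?_, ?_, ?_⟩
    · refine Set.union_subset ?_ hK
      intro x hx
      obtain ⟨⟨h1 | h1, -⟩, h2⟩ := hK1 hx
      · exact absurd (h1 ▸ hs.1) h2
      · exact ⟨h1, h2⟩
    · refine (Set.encard_union_le _ _).trans ?_
      push_cast
      exact add_le_add hK1c (Set.encard_le_one_iff_subsingleton.2 hKs)
    · refine hL1.mono ?_
      rintro x (hx | ⟨hx, hx2⟩)
      · exact Or.inl hx
      · exact Or.inr ⟨⟨Or.inr hx, fun h => hx2 (Or.inr h)⟩, fun h => hx2 (Or.inl h)⟩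

/-- If `X'` is `(X,Y)`-finitely extendable and `X'` is joinable to `Y \ U` in `D - U`
for a finite `U` disjoint from `X'`, then `U` extends by at most `|U|` vertices of
`X \ X'` to a set `W` such that `X' \ W` is `(X \ W, Y \ W)`-finitely extendable
in `D - W`. -/
theorem stmt8 {V : Type u} (E : Set (V × V)) (X Y : Set V)
    (hX : ∀ e ∈ E, e.2 ∉ X) (hY : ∀ e ∈ E, e.1 ∉ Y)
    (X' : Set V) (hfe : FinExtendable E X Y X')
    (U : Set V) (hU : U.Finite) (hUX' : Disjoint U X')
    (hjoin : Joinable {e ∈ E | e.1 ∉ U ∧ e.2 ∉ U} X' (Y \ U)) :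
    ∃ W : Set V, U ⊆ W ∧ W \ U ⊆ X \ X' ∧ (W \ U).Finite ∧
      (W \ U).ncard ≤ U.ncard ∧
      FinExtendable {e ∈ E | e.1 ∉ W ∧ e.2 ∉ W} (X \ W) (Y \ W) (X' \ W) := by
  classical
  set E' : Set (V × V) := {e ∈ E | e.1 ∉ U ∧ e.2 ∉ U} with hE'
  have hE'E : E' ⊆ E := fun e he => he.1
  have hX1 : ∀ e ∈ E', e.2 ∉ X := fun e he => hX e he.1
  have hX'X : X' ⊆ X := hfe.1
  have hL0 : Lk E' (Y \ U) X' := hjoin.lk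
  have step1 : ∀ F : Finset V, (F : Set V) ⊆ (X \ X') \ U → ∃ C ⊆ F, C.card ≤ U.ncard ∧
      Lk E' (Y \ U) (X' ∪ ((F \ C : Finset V) : Set V)) := by
    intro F hF
    have hFX : X' ∪ (F : Set V) ⊆ X := Set.union_subset hX'X (fun x hx => (hF hx).1.1)
    have hj := hfe.2 (X' ∪ F) Set.subset_union_left hFX
      ((Finset.finite_toSet F).subset (by rintro x ⟨h | h, h'⟩; exacts [absurd h h', h]))
    obtain ⟨f, hf1, hf2⟩ := hj.lk
    let T : Set V := {a | a ∈ X' ∪ (F : Set V) ∧ ∃ v ∈ f a, v ∈ U}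
    have hTU : T.encard ≤ U.encard := by
      have : ∀ a ∈ T, ∃ v, v ∈ f a ∧ v ∈ U := fun a ha => ha.2
      choose! g hg1 hg2 using this
      refine Set.encard_le_encard_of_injOn (f := g) (fun a ha => hg2 a ha) ?_
      intro a ha b hb hab
      exact hf2 a ha.1 b hb.1 (g a) (hg1 a ha) (by rw [hab]; exact hg1 b hb)
    have hTfin : T.Finite := by
      rw [← Set.encard_lt_top_iff]
      exact hTU.trans_lt hU.encard_lt_top
    have hJL : Lk E' (Y \ U) ((X' ∪ (F : Set V)) \ T) := by
      refine ⟨f, fun a ha => (hf1 a ha.1).restrict ?_, fun a ha b hb => hf2 a ha.1 b hb.1⟩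
      intro v hv hvU
      exact ha.2 ⟨ha.1, v, hv, hvU⟩
    have hXJ : X' \ ((X' ∪ (F : Set V)) \ T) = X' ∩ T := by
      ext x
      constructor
      · rintro ⟨h1, h2⟩
        exact ⟨h1, by by_contra h; exact h2 ⟨Or.inl h1, h⟩⟩
      · rintro ⟨h1, h2⟩
        exact ⟨h1, fun h => h.2 h2⟩
    have hfinXT : (X' ∩ T).Finite := hTfin.subset Set.inter_subset_right
    obtain ⟨K, hK, hKc, hKL⟩ := exchange hX1 hX'X hL0 (X' ∩ T).ncard _ hJL
      (by rw [hXJ, hfinXT.cast_ncard_eq])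
    have hC : ((F.filter (fun x => x ∈ T ∨ x ∈ K) : Finset V) : Set V) ⊆ (T \ X') ∪ K := by
      intro x hx
      simp only [Finset.coe_filter] at hx
      rcases hx with ⟨hxF, h | h⟩
      · exact Or.inl ⟨h, (hF hxF).1.2⟩
      · exact Or.inr h
    refine ⟨F.filter (fun x => x ∈ T ∨ x ∈ K), Finset.filter_subset _ _, ?_, ?_⟩
    · have h1 := (Set.encard_le_encard hC).trans (Set.encard_union_le _ _)
      rw [hfinXT.cast_ncard_eq] at hKc
      have h2 : (T \ X').encard + K.encard ≤ T.encard := by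
        refine (add_le_add_right hKc _).trans ?_
        rw [Set.inter_comm, Set.encard_diff_add_encard_inter]
      have h3 := (h1.trans h2).trans hTU
      rw [Set.encard_coe_eq_coe_finsetCard, ← hU.cast_ncard_eq] at h3
      exact_mod_cast h3
    · refine hKL.mono ?_
      rintro x (hx | hx)
      · exact Or.inl hx
      · simp only [Finset.coe_sdiff, Finset.coe_filter] at hx
        exact Or.inr ⟨⟨Or.inr hx.1, fun h => hx.2 ⟨hx.1, Or.inl h⟩⟩, fun h => hx.2 ⟨hx.1, Or.inr h⟩⟩
  -- maximal defect
  let Pk : ℕ → Prop := fun k => ∃ F : Finset V, (F : Set V) ⊆ (X \ X') \ U ∧ ∀ C ⊆ F,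
    Lk E' (Y \ U) (X' ∪ ((F \ C : Finset V) : Set V)) → k ≤ C.card
  have hmax : ∃ k, Pk k ∧ ¬ Pk (k + 1) := by
    by_contra hcon
    push Not at hcon
    have hall : ∀ k, Pk k := by
      intro k
      induction k with
      | zero => exact ⟨∅, by simp, fun _ _ _ => Nat.zero_le _⟩
      | succ k ih => exact hcon k ih
    obtain ⟨F, hF, hF2⟩ := hall (U.ncard + 1)
    obtain ⟨C, hC, hC1, hC2⟩ := step1 F hF
    have := hF2 C hC hC2
    omega
  obtain ⟨k, ⟨F0, hF0, hF0k⟩, hnk⟩ := hmax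
  have hmin : ∀ F : Finset V, (F : Set V) ⊆ (X \ X') \ U → ∃ C ⊆ F, C.card ≤ k ∧
      Lk E' (Y \ U) (X' ∪ ((F \ C : Finset V) : Set V)) := by
    intro F hF
    by_contra hcon
    push Not at hcon
    exact hnk ⟨F, hF, fun C hC hL => by
      by_contra h
      exact hcon C hC (by omega) hL⟩
  obtain ⟨B, hBF, hBk, hBL⟩ := hmin F0 hF0
  have hBU : B.card ≤ U.ncard := by
    obtain ⟨C, hC, hC1, hC2⟩ := step1 F0 hF0
    exact hBk.trans ((hF0k C hC hC2).trans hC1)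
  have main : ∀ G : Finset V, (G : Set V) ⊆ (X \ X') \ U → Disjoint G B →
      Lk E' (Y \ U) (X' ∪ (G : Set V)) := by
    intro G hG hGB
    have hF : ((G ∪ F0 : Finset V) : Set V) ⊆ (X \ X') \ U := by
      rw [Finset.coe_union]; exact Set.union_subset hG hF0
    obtain ⟨B', hB', hB'k, hB'L⟩ := hmin _ hF
    set F := G ∪ F0 with hFdef
    have hIX : X' ∪ ((F0 \ B : Finset V) : Set V) ⊆ X := by
      refine Set.union_subset hX'X fun x hx => ?_
      exact (hF0 (Finset.mem_sdiff.1 (Finset.mem_coe.1 hx)).1).1.1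
    have hIJ : (X' ∪ ((F0 \ B : Finset V) : Set V)) \ (X' ∪ ((F \ B' : Finset V) : Set V))
        = (((F0 \ B) ∩ B' : Finset V) : Set V) := by
      ext x
      have hx1 : x ∈ F0 → x ∉ X' := fun h => (hF0 h).1.2
      have hx2 : x ∈ F0 → x ∈ F := fun h => Finset.mem_union_right _ h
      simp only [Set.mem_sdiff, Set.mem_union, Finset.mem_coe, Finset.mem_sdiff, Finset.mem_inter]
      tauto
    obtain ⟨K, hK, hKc, hKL⟩ := exchange hX1 hIX hBL ((F0 \ B) ∩ B').card _ hB'L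
      (by rw [hIJ, Set.encard_coe_eq_coe_finsetCard])
    have hKfin : K.Finite := Set.finite_of_encard_le_coe hKc
    set K' := hKfin.toFinset with hK'
    have hKK : ∀ x, x ∈ K' ↔ x ∈ K := fun x => hKfin.mem_toFinset
    have hK'c : K'.card ≤ ((F0 \ B) ∩ B').card := by
      have : K = (K' : Set V) := by ext x; simp [hK']
      rw [this, Set.encard_coe_eq_coe_finsetCard] at hKc
      exact_mod_cast hKc
    set C := (B' \ (F0 \ B)) ∪ K' with hC
    have hCk : C.card ≤ k := by
      have h1 := Finset.card_union_le (B' \ (F0 \ B)) K'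
      have h2 := Finset.card_sdiff_add_card_inter B' (F0 \ B)
      rw [Finset.inter_comm] at h2
      rw [← hC] at h1
      omega
    have hCdis : ∀ x ∈ C, x ∉ F0 \ B := by
      intro x hx
      rcases Finset.mem_union.1 hx with h | h
      · exact (Finset.mem_sdiff.1 h).2
      · exact fun h2 => (hK ((hKK x).1 h)).2 (Or.inr h2)
    have hCL : Lk E' (Y \ U) (X' ∪ ((F \ C : Finset V) : Set V)) := by
      refine hKL.mono ?_
      rintro x (hx | hx)
      · exact Or.inl (Or.inl hx)
      · have hx' := Finset.mem_sdiff.1 (Finset.mem_coe.1 hx)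
        by_cases hx2 : x ∈ F0 \ B
        · exact Or.inl (Or.inr hx2)
        · refine Or.inr ⟨Or.inr (Finset.mem_coe.2 (Finset.mem_sdiff.2 ⟨hx'.1, fun h => ?_⟩)), fun h => ?_⟩
          · exact hx'.2 (Finset.mem_union_left _ (Finset.mem_sdiff.2 ⟨h, hx2⟩))
          · exact hx'.2 (Finset.mem_union_right _ ((hKK x).2 h))
    have hk2 : k ≤ (C ∩ F0).card := by
      refine hF0k _ Finset.inter_subset_right (hCL.mono ?_)
      refine Set.union_subset_union_right _ ?_
      intro x hx
      have hx' := Finset.mem_sdiff.1 (Finset.mem_coe.1 hx)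
      refine Finset.mem_coe.2 (Finset.mem_sdiff.2 ⟨Finset.mem_union_right _ hx'.1, fun h => ?_⟩)
      exact hx'.2 (Finset.mem_inter.2 ⟨h, hx'.1⟩)
    have e1 : C ∩ F0 = C := Finset.eq_of_subset_of_card_le Finset.inter_subset_left (hCk.trans hk2)
    have hCB : C ⊆ B := by
      intro x hx
      have h1 := hCdis x hx
      have h2 : x ∈ F0 := (Finset.mem_inter.1 (e1.symm ▸ hx)).2
      by_contra h3
      exact h1 (Finset.mem_sdiff.2 ⟨h2, h3⟩)
    refine hCL.mono (Set.union_subset_union_right _ ?_)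
    intro x hx
    refine Finset.mem_coe.2 (Finset.mem_sdiff.2 ⟨Finset.mem_union_left _ hx, fun h => ?_⟩)
    exact Finset.disjoint_left.1 hGB hx (hCB h)
  have hBZ : (B : Set V) ⊆ (X \ X') \ U := fun x hx => hF0 (hBF hx)
  have hWU : (U ∪ (B : Set V)) \ U = B := by
    ext x
    constructor
    · rintro ⟨h | h, h'⟩
      · exact absurd h h'
      · exact h
    · intro h
      exact ⟨Or.inr h, (hBZ h).2⟩
  have hX'W : X' \ (U ∪ (B : Set V)) = X' := by
    ext x
    constructor
    · exact fun h => h.1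
    · intro h
      refine ⟨h, ?_⟩
      rintro (h' | h')
      · exact Set.disjoint_left.1 hUX' h' h
      · exact (hBZ h').1.2 h
  refine ⟨U ∪ B, Set.subset_union_left, ?_, ?_, ?_, ?_⟩
  · rw [hWU]; exact fun x hx => (hBZ hx).1
  · rw [hWU]; exact Finset.finite_toSet B
  · rw [hWU, Set.ncard_coe_finset]; exact hBU
  · rw [hX'W]
    refine ⟨fun x hx => ⟨hX'X hx, fun h => (hX'W.symm ▸ hx : x ∈ X' \ (U ∪ (B : Set V))).2 h⟩, ?_⟩
    intro O hO1 hO2 hO3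
    have hG := main hO3.toFinset (by
      intro x hx
      have hx' : x ∈ O \ X' := by simpa using hx
      exact ⟨⟨(hO2 hx'.1).1, hx'.2⟩, fun h => (hO2 hx'.1).2 (Or.inl h)⟩) (by
      refine Finset.disjoint_left.2 fun x hx hxB => ?_
      have hx' : x ∈ O \ X' := by simpa using hx
      exact (hO2 hx'.1).2 (Or.inr hxB))
    have hOL : Lk E' (Y \ U) O := by
      refine hG.mono fun x hx => ?_
      by_cases h : x ∈ X'
      · exact Or.inl h
      · right
        simp [hx, h]
    have hfin : Lk {e ∈ E | e.1 ∉ U ∪ (B : Set V) ∧ e.2 ∉ U ∪ (B : Set V)} (Y \ (U ∪ B)) O := by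
      obtain ⟨f, hf1, hf2⟩ := hOL
      refine ⟨f, fun a ha => ?_, hf2⟩
      have h0 := hf1 a ha
      refine (h0.mono hE'E Set.sdiff_subset).restrict ?_
      rintro v hv (hvU | hvB)
      · have hnX : ∀ e ∈ E', e.2 ∉ U := fun e he => he.2.2
        have := h0.eq_start hnX hv hvU
        subst this
        exact (hO2 ha).2 (Or.inl hvU)
      · have := h0.eq_start hX1 hv (hBZ hvB).1.1
        subst this
        exact (hO2 ha).2 (Or.inr hvB)
    refine hfin.joinable (X := X) ?_ ?_ (fun x hx => (hO2 hx).1)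
    · exact fun e he => hX e he.1
    · exact fun e he h => hY e he.1 h.1
end

section
/- Let D be a digraph and X, Y vertex sets, and let X' ⊆ X be countable and (X,Y)-finitely extendable in D. Then for every countable family (V_i : i ∈ ℕ) of infinite subsets of X\X', there exists a set O with X' ⊆ O ⊆ X such that O is joinable to Y in D and O ∩ V_i ≠ ∅ for every i ∈ ℕ. -/
/-!  Common framework: digraphs as edge sets on a vertex type, directed paths,
path-systems, separations, flames and largeness. -/

universe u

variable {V : Type u}

namespace FlameLink

/-- `w` may be matched to `u`. -/
def Adm (E : Set (V × V)) (X : Set V) (u w : V) : Prop := (u, w) ∈ E ∨ (w = u ∧ u ∉ X)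

/-- The domain of successor functions for the start set `O`. -/
def Dm (X Y O : Set V) : Set V := {v | v ∉ Y ∧ (v ∈ X → v ∈ O)}

/-- `s` encodes a matching for start set `O`. -/
def Mat (E : Set (V × V)) (X Y O : Set V) (s : V → V) : Prop :=
  (∀ v ∈ Dm X Y O, Adm E X v (s v)) ∧ Set.InjOn s (Dm X Y O)

/-- termination at a vertex -/
def Trm (Y : Set V) (s : V → V) (v : V) : Prop := s v = v ∨ ∃ n, s^[n] v ∈ Y

/-- `O` is linkable, in terms of successor functions. -/
def LK (E : Set (V × V)) (X Y O : Set V) : Prop :=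
  ∃ s, Mat E X Y O s ∧ ∀ v ∈ Dm X Y O, Trm Y s v

lemma LK.mono {E : Set (V × V)} {X Y O O' : Set V} (h : LK E X Y O) (hO : O' ⊆ O) :
    LK E X Y O' := by
  obtain ⟨s, ⟨h1, h2⟩, h3⟩ := h
  have : Dm X Y O' ⊆ Dm X Y O := fun v hv => ⟨hv.1, fun hx => hO (hv.2 hx)⟩
  exact ⟨s, ⟨fun v hv => h1 v (this hv), h2.mono this⟩, fun v hv => h3 v (this hv)⟩

section
variable {E : Set (V × V)} {X Y : Set V}

lemma Adm.notMem (hX : ∀ e ∈ E, e.2 ∉ X) {u w : V} (h : Adm E X u w) : w ∉ X := by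
  rcases h with h | ⟨rfl, h⟩
  · exact hX _ h
  · exact h

/-- iterates of a start vertex before reaching `Y` lie in the domain. -/
lemma Mat.iter_mem (hX : ∀ e ∈ E, e.2 ∉ X) {O : Set V} {s : V → V} (h : Mat E X Y O s) {o : V}
    (ho : o ∈ O) : ∀ n, (∀ j ≤ n, s^[j] o ∉ Y) → s^[n] o ∈ Dm X Y O
  | 0, hn => ⟨hn 0 le_rfl, fun _ => ho⟩
  | n+1, hn => by
    have h1 := iter_mem hX h ho n (fun j hj => hn j (by omega))
    refine ⟨hn _ le_rfl, fun hx => ?_⟩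
    rw [Function.iterate_succ_apply'] at hx
    exact absurd hx ((h.1 _ h1).notMem hX)

lemma Mat.iter_notMem (hX : ∀ e ∈ E, e.2 ∉ X) {O : Set V} {s : V → V} (h : Mat E X Y O s) {o : V}
    (ho : o ∈ O) (n : ℕ) (hn : ∀ j < n + 1, s^[j] o ∉ Y) : s^[n+1] o ∉ X := by
  rw [Function.iterate_succ_apply']
  exact (h.1 _ (h.iter_mem hX ho n (fun j hj => hn j (by omega)))).notMem hX

/-- orbits of start vertices are disjoint and injective -/
lemma Mat.iter_inj (hX : ∀ e ∈ E, e.2 ∉ X) {O : Set V} {s : V → V} (h : Mat E X Y O s) (hO : O ⊆ X) {o o' : V}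
    (ho : o ∈ O) (ho' : o' ∈ O) : ∀ i j, (∀ k < i, s^[k] o ∉ Y) → (∀ k < j, s^[k] o' ∉ Y) →
      s^[i] o = s^[j] o' → i = j ∧ o = o'
  | 0, 0, _, _, e => ⟨rfl, e⟩
  | 0, j+1, _, h2, e => by
    exact absurd (hO ho) (by
      have := h.iter_notMem hX ho' j h2
      rw [← e] at this; exact this)
  | i+1, 0, h1, _, e => by
    exact absurd (hO ho') (by
      have := h.iter_notMem hX ho i h1
      rw [e] at this; exact this)
  | i+1, j+1, h1, h2, e => by
    rw [Function.iterate_succ_apply', Function.iterate_succ_apply'] at e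
    have e' := h.2 (h.iter_mem hX ho i (fun k hk => h1 k (by omega)))
      (h.iter_mem hX ho' j (fun k hk => h2 k (by omega))) e
    obtain ⟨a, b⟩ := iter_inj hX h hO ho ho' i j (fun k hk => h1 k (by omega))
      (fun k hk => h2 k (by omega)) e'
    exact ⟨by omega, b⟩

lemma Mat.orbit_contra (hX : ∀ e ∈ E, e.2 ∉ X) {O : Set V} {s t : V → V} (h : Mat E X Y O s) (hO : O ⊆ X) {o : V}
    (ho : o ∈ O) (hY : ∀ n, s^[n] o ∉ Y) (N : ℕ)
    (ht : ∀ n ≥ N, t (s^[n] o) = s (s^[n] o)) (hT : Trm Y t (s^[N] o)) : False := by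
  have key : ∀ k, t^[k] (s^[N] o) = s^[N+k] o := by
    intro k
    induction k with
    | zero => rfl
    | succ k ih =>
      rw [Function.iterate_succ_apply', ih, ht _ (by omega), ← Function.iterate_succ_apply' s]
      rfl
  rcases hT with hT | ⟨n, hn⟩
  · rw [ht N le_rfl, ← Function.iterate_succ_apply' s] at hT
    have := (h.iter_inj hX hO ho ho _ _ (fun k _ => hY k) (fun k _ => hY k) hT).1
    omega
  · rw [key] at hn
    exact hY _ hn

/-- Weak linkings can be cleaned up. -/
lemma LK.of_weak {O : Set V} {s : V → V} (h : Mat E X Y O s)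
    (hT : ∀ o ∈ O, ∃ n, s^[n] o ∈ Y) : LK E X Y O := by
  classical
  let Orb : Set V := {v | ∃ o ∈ O, ∃ i, (∀ j < i, s^[j] o ∉ Y) ∧ s^[i] o = v}
  have hstep : ∀ v ∈ Orb, v ∉ Y → s v ∈ Orb := by
    rintro v ⟨o, ho, i, hi, rfl⟩ hv
    refine ⟨o, ho, i+1, fun j hj => ?_, Function.iterate_succ_apply' _ _ _⟩
    rcases Nat.lt_succ_iff_lt_or_eq.1 hj with h | rfl
    · exact hi j h
    · exact hv
  let s' : V → V := fun v => if v ∈ Orb then s v else v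
  have e1 : ∀ v ∈ Orb, s' v = s v := fun v hv => if_pos hv
  have e2 : ∀ v ∉ Orb, s' v = v := fun v hv => if_neg hv
  refine ⟨s', ⟨fun v hv => ?_, fun v hv w hw e => ?_⟩, fun v hv => ?_⟩
  · by_cases hvo : v ∈ Orb
    · rw [e1 v hvo]; exact h.1 v hv
    · rw [e2 v hvo]
      refine Or.inr ⟨rfl, fun hx => hvo ⟨v, hv.2 hx, 0, by simp, rfl⟩⟩
  · by_cases hvo : v ∈ Orb <;> by_cases hwo : w ∈ Orb
    · rw [e1 v hvo, e1 w hwo] at e; exact h.2 hv hw e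
    · rw [e1 v hvo, e2 w hwo] at e
      exact absurd (e ▸ hstep v hvo hv.1) hwo
    · rw [e2 v hvo, e1 w hwo] at e
      exact absurd (e ▸ hstep w hwo hw.1) hvo
    · rwa [e2 v hvo, e2 w hwo] at e
  · by_cases hvo : v ∈ Orb
    · right
      by_contra hcon
      push Not at hcon
      obtain ⟨o, ho, i, hi, rfl⟩ := hvo
      have key : ∀ k, s'^[k] (s^[i] o) = s^[i+k] o ∧ ∀ j < i + k, s^[j] o ∉ Y := by
        intro k
        induction k with
        | zero => exact ⟨rfl, hi⟩
        | succ k ih =>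
          have h0 := hcon k
          rw [ih.1] at h0
          refine ⟨?_, fun j hj => ?_⟩
          · rw [Function.iterate_succ_apply', ih.1, e1 _ ⟨o, ho, _, ih.2, rfl⟩,
              ← Function.iterate_succ_apply' s]
            rfl
          · rcases Nat.lt_succ_iff_lt_or_eq.1 (show j < (i+k)+1 by omega) with h | rfl
            · exact ih.2 j h
            · exact h0
      obtain ⟨n, hn⟩ := hT o ho
      exact (key (n+1)).2 n (by omega) hn
    · exact Or.inl (e2 v hvo)

/-- A finite modification of a linking is a linking. -/
lemma LK.of_finite_mod (hX : ∀ e ∈ E, e.2 ∉ X) {L O : Set V} {s s' : V → V} (hO : O ⊆ X)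
    (hs : ∀ v ∈ Dm X Y L, Trm Y s v) (h : Mat E X Y O s')
    (hfin : {v | s' v ≠ s v}.Finite) : LK E X Y O := by
  refine LK.of_weak h fun o ho => ?_
  by_contra hcon
  push Not at hcon
  have hinj : Function.Injective fun n => s'^[n] o := fun i j e =>
    (h.iter_inj hX hO ho ho i j (fun k _ => hcon k) (fun k _ => hcon k) e).1
  have hf := hfin.preimage (hinj.injOn (s := _))
  obtain ⟨N, hN⟩ := hf.bddAbove
  refine h.orbit_contra hX hO ho hcon (t := s) (N+1) (fun n hn => ?_) ?_
  · by_contra hne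
    have := hN (show n ∈ _ from fun e => hne e.symm)
    omega
  · exact hs _ ⟨hcon _, fun hx => absurd hx (h.iter_notMem hX ho N (fun k _ => hcon k))⟩

end

/-- Vertices reached by alternating walks. -/
def Rch (E : Set (V × V)) (X Y L K : Set V) (s : V → V) : ℕ → Set V
  | 0 => K
  | n+1 => Rch E X Y L K s n ∪
      {v | v ∈ Dm X Y L ∧ ∃ u ∈ Rch E X Y L K s n, Adm E X u (s v)}

section
variable {E : Set (V × V)} {X Y : Set V}

lemma Rch.spec {L K : Set V} {s : V → V} (hs : Mat E X Y L s)
    (hKY : ∀ a ∈ K, a ∉ Y) :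
    ∀ n, ∀ u ∈ Rch E X Y L K s n, ∃ a ∈ K, ∃ s' : V → V, u ∈ Dm X Y (insert a L) ∧
      (∀ v ∈ Dm X Y (insert a L), v ≠ u → Adm E X v (s' v)) ∧
      Set.InjOn s' (Dm X Y (insert a L) \ {u}) ∧
      (∀ v ∈ Dm X Y (insert a L), v ≠ u → s' v ∈ s '' Dm X Y L) ∧
      {v | s' v ≠ s v}.Finite ∧ {v | s' v ≠ s v} ⊆ Rch E X Y L K s n := by
  classical
  intro n
  induction n with
  | zero =>
    intro u hu
    have hD : ∀ v ∈ Dm X Y (insert u L), v ≠ u → v ∈ Dm X Y L := fun v hv hne =>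
      ⟨hv.1, fun hx => (hv.2 hx).resolve_left hne⟩
    refine ⟨u, hu, s, ⟨hKY u hu, fun _ => Or.inl rfl⟩, fun v hv hne => hs.1 v (hD v hv hne),
      fun v hv w hw e => hs.2 (hD v hv.1 hv.2) (hD w hw.1 hw.2) e,
      fun v hv hne => ⟨v, hD v hv hne, rfl⟩, by simp, by simp⟩
  | succ n ih =>
    intro v hv
    by_cases hvn : v ∈ Rch E X Y L K s n
    · obtain ⟨a, ha, s', h1, h2, h3, h4, h5, h6⟩ := ih v hvn
      exact ⟨a, ha, s', h1, h2, h3, h4, h5, h6.trans Set.subset_union_left⟩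
    rcases hv with hv | ⟨hvD, u, hu, huv⟩
    · exact absurd hv hvn
    obtain ⟨a, ha, s', h1, h2, h3, h4, h5, h6⟩ := ih u hu
    have hvu : v ≠ u := fun e => hvn (e ▸ hu)
    have hvs : s' v = s v := by
      by_contra hne
      exact hvn (h6 hne)
    have hvD' : v ∈ Dm X Y (insert a L) := ⟨hvD.1, fun hx => Or.inr (hvD.2 hx)⟩
    have eu : Function.update s' u (s v) u = s v := Function.update_self ..
    have en : ∀ w, w ≠ u → Function.update s' u (s v) w = s' w := fun w hw =>
      Function.update_of_ne hw _ _
    have hsub : {w | Function.update s' u (s v) w ≠ s w} ⊆ insert u {w | s' w ≠ s w} := by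
      intro w hw
      by_cases hwu : w = u
      · exact Or.inl hwu
      · right
        simpa [en w hwu] using hw
    refine ⟨a, ha, Function.update s' u (s v), hvD', fun w hw hne => ?_, ?_, fun w hw hne => ?_,
      (h5.insert u).subset hsub, hsub.trans ?_⟩
    · by_cases hwu : w = u
      · subst hwu; rw [eu]; exact huv
      · rw [en w hwu]; exact h2 w hw hwu
    · rintro w ⟨hw, hwv⟩ z ⟨hz, hzv⟩ e
      by_cases hwu : w = u <;> by_cases hzu : z = u
      · rw [hwu, hzu]
      · rw [hwu, eu, en z hzu, ← hvs] at e
        exact absurd (h3 ⟨hvD', hvu⟩ ⟨hz, hzu⟩ e).symm hzv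
      · rw [hzu, eu, en w hwu, ← hvs] at e
        exact absurd (h3 ⟨hw, hwu⟩ ⟨hvD', hvu⟩ e) hwv
      · rw [en w hwu, en z hzu] at e
        exact h3 ⟨hw, hwu⟩ ⟨hz, hzu⟩ e
    · by_cases hwu : w = u
      · subst hwu; rw [eu]; exact ⟨v, hvD, rfl⟩
      · rw [en w hwu]; exact h4 w hw hwu
    · rintro w (rfl | hw)
      · exact Or.inl hu
      · exact Or.inl (h6 hw)

lemma aug_core (hX : ∀ e ∈ E, e.2 ∉ X) {I K F : Set V} (hI : I ⊆ X) (hF : F ⊆ X) (hK : K ⊆ I)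
    (hFI : ∀ f ∈ F, f ∉ I) (h1 : LK E X Y (I \ K ∪ F)) (h2 : LK E X Y I) :
    LK E X Y (I ∪ F) ∨ (∃ a ∈ K, LK E X Y (insert a (I \ K ∪ F))) ∨
      ∃ a ∈ K, ∃ f ∈ F, LK E X Y (insert a ((I \ K ∪ F) \ {f})) := by
  classical
  obtain ⟨s, hs, hsT⟩ := h1
  obtain ⟨t, ht, htT⟩ := h2
  set L := I \ K ∪ F with hL
  have hLX : L ⊆ X := Set.union_subset (Set.sdiff_subset.trans hI) hF
  have hKL : ∀ a ∈ K, a ∉ L := by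
    rintro a ha (h | h)
    · exact h.2 ha
    · exact hFI a h (hK ha)
  by_cases hKY : ∃ a ∈ K, a ∈ Y
  · obtain ⟨a, ha, haY⟩ := hKY
    right; left
    have hD : Dm X Y (insert a L) ⊆ Dm X Y L := fun v hv =>
      ⟨hv.1, fun hx => (hv.2 hx).resolve_left (fun e => hv.1 (e ▸ haY))⟩
    exact ⟨a, ha, s, ⟨fun v hv => hs.1 v (hD hv), hs.2.mono hD⟩, fun v hv => hsT v (hD hv)⟩
  push Not at hKY
  by_contra hcon
  push Not at hcon
  obtain ⟨c1, c2, c3⟩ := hcon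
  have spec := Rch.spec hs hKY
  let R : Set V := {v | ∃ n, v ∈ Rch E X Y L K s n}
  -- no free vertex is reached
  have hR1 : ∀ u ∈ R, ∀ w, Adm E X u w → ∃ v ∈ R, v ∈ Dm X Y L ∧ s v = w := by
    rintro u ⟨n, hu⟩ w hw
    by_cases hex : ∃ v ∈ Dm X Y L, s v = w
    · obtain ⟨v, hv, rfl⟩ := hex
      exact ⟨v, ⟨n+1, Or.inr ⟨hv, u, hu, hw⟩⟩, hv, rfl⟩
    exfalso
    obtain ⟨a, ha, s', g1, g2, g3, g4, g5, g6⟩ := spec n u hu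
    have eu : Function.update s' u w u = w := Function.update_self ..
    have en : ∀ z, z ≠ u → Function.update s' u w z = s' z := fun z hz =>
      Function.update_of_ne hz _ _
    refine c2 a ha (LK.of_finite_mod hX (s := s) (s' := Function.update s' u w) (L := L)
      (Set.insert_subset (hI (hK ha)) hLX) hsT ⟨fun v hv => ?_, fun v hv z hz e => ?_⟩ ?_)
    · by_cases hvu : v = u
      · subst hvu; rw [eu]; exact hw
      · rw [en v hvu]; exact g2 v hv hvu
    · by_cases hvu : v = u <;> by_cases hzu : z = u
      · rw [hvu, hzu]
      · rw [hvu, eu, en z hzu] at e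
        exact absurd (e ▸ g4 z hz hzu) hex
      · rw [hzu, eu, en v hvu] at e
        exact absurd (e ▸ g4 v hv hvu) hex
      · rw [en v hvu, en z hzu] at e
        exact g3 ⟨hv, hvu⟩ ⟨hz, hzu⟩ e
    · refine (g5.insert u).subset fun v hv => ?_
      by_cases hvu : v = u
      · exact Or.inl hvu
      · right
        simpa [en v hvu] using hv
  have hR2 : ∀ f ∈ F, f ∉ R := by
    rintro f hf ⟨n, hn⟩
    obtain ⟨a, ha, s', g1, g2, g3, g4, g5, g6⟩ := spec n f hn
    have hfa : f ≠ a := fun e => hFI f hf (e ▸ hK ha)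
    have hD : ∀ v ∈ Dm X Y (insert a (L \ {f})), v ∈ Dm X Y (insert a L) ∧ v ≠ f := by
      intro v hv
      refine ⟨⟨hv.1, fun hx => (hv.2 hx).imp id fun h => h.1⟩, ?_⟩
      rintro rfl
      rcases hv.2 (hF hf) with h | h
      · exact hfa h
      · exact h.2 rfl
    refine c3 a ha f hf (LK.of_finite_mod hX (s := s) (s' := s') (L := L)
      (Set.insert_subset (hI (hK ha)) (Set.sdiff_subset.trans hLX)) hsT
      ⟨fun v hv => g2 v (hD v hv).1 (hD v hv).2, fun v hv z hz e => g3 (hD v hv) (hD z hz) e⟩ g5)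
  have hKR : ∀ a ∈ K, a ∈ R := fun a ha => ⟨0, ha⟩
  have hIF : I ∪ F ⊆ X := Set.union_subset hI hF
  -- the combined successor function
  let r : V → V := fun v => if v ∈ R then t v else s v
  have r1 : ∀ v ∈ R, r v = t v := fun v hv => if_pos hv
  have r2 : ∀ v ∉ R, r v = s v := fun v hv => if_neg hv
  have d1 : ∀ v ∈ Dm X Y (I ∪ F), v ∈ R → v ∈ Dm X Y I := fun v hv hR =>
    ⟨hv.1, fun hx => (hv.2 hx).resolve_right fun h => hR2 v h hR⟩
  have d2 : ∀ v ∈ Dm X Y (I ∪ F), v ∉ R → v ∈ Dm X Y L := fun v hv hR =>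
    ⟨hv.1, fun hx => (hv.2 hx).imp (fun h => ⟨h, fun hk => hR (hKR v hk)⟩) id⟩
  have mix : ∀ v ∈ Dm X Y (I ∪ F), ∀ w ∈ Dm X Y (I ∪ F), v ∈ R → w ∉ R → t v ≠ s w := by
    intro v hv w hw hvR hwR e
    obtain ⟨z, hzR, hzD, hz⟩ := hR1 v hvR (t v) (ht.1 v (d1 v hv hvR))
    rw [e] at hz
    exact hwR (hs.2 hzD (d2 w hw hwR) hz ▸ hzR)
  have hr : Mat E X Y (I ∪ F) r := by
    refine ⟨fun v hv => ?_, fun v hv w hw e => ?_⟩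
    · by_cases hvR : v ∈ R
      · rw [r1 v hvR]; exact ht.1 v (d1 v hv hvR)
      · rw [r2 v hvR]; exact hs.1 v (d2 v hv hvR)
    · by_cases hvR : v ∈ R <;> by_cases hwR : w ∈ R
      · rw [r1 v hvR, r1 w hwR] at e; exact ht.2 (d1 v hv hvR) (d1 w hw hwR) e
      · rw [r1 v hvR, r2 w hwR] at e; exact absurd e (mix v hv w hw hvR hwR)
      · rw [r2 v hvR, r1 w hwR] at e; exact absurd e.symm (mix w hw v hv hwR hvR)
      · rw [r2 v hvR, r2 w hwR] at e; exact hs.2 (d2 v hv hvR) (d2 w hw hwR) e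
  refine c1 (LK.of_weak hr fun o ho => ?_)
  by_contra hcY
  push Not at hcY
  have hmem : ∀ n, r^[n] o ∈ Dm X Y (I ∪ F) := fun n => hr.iter_mem hX ho n fun j _ => hcY j
  by_cases hall : ∀ n, r^[n] o ∈ R
  · exact hr.orbit_contra hX hIF ho hcY (t := t) 0 (fun n _ => (r1 _ (hall n)).symm)
      (htT _ (d1 _ (hmem 0) (hall 0)))
  push Not at hall
  obtain ⟨N, hN⟩ := hall
  have hNR : ∀ k, r^[N+k] o ∉ R := by
    intro k
    induction k with
    | zero => exact hN
    | succ k ih =>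
      intro hR
      have e : r^[N+(k+1)] o = s (r^[N+k] o) := by
        rw [← r2 _ ih, ← Function.iterate_succ_apply' r]; rfl
      have hx : r^[N+(k+1)] o ∉ X := hr.iter_notMem hX ho (N+k) fun j _ => hcY j
      obtain ⟨z, hzR, hzD, hz⟩ := hR1 _ hR _ (Or.inr ⟨rfl, hx⟩)
      rw [e] at hz
      exact ih (hs.2 hzD (d2 _ (hmem _) ih) hz ▸ hzR)
  refine hr.orbit_contra hX hIF ho hcY (t := s) N (fun n hn => ?_) (hsT _ (d2 _ (hmem N) hN))
  obtain ⟨k, rfl⟩ := Nat.exists_eq_add_of_le hn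
  exact (r2 _ (hNR k)).symm

/-- The exchange lemma. -/
lemma exchange (hX : ∀ e ∈ E, e.2 ∉ X) {I : Set V} (hI : I ⊆ X) (h2 : LK E X Y I) :
    ∀ (n : ℕ) (K : Set V), K.Finite → K.ncard = n → K ⊆ I → ∀ F : Set V, F ⊆ X →
      (∀ f ∈ F, f ∉ I) → LK E X Y (I \ K ∪ F) →
      ∃ G ⊆ F, G.Finite ∧ G.ncard ≤ n ∧ LK E X Y (I ∪ (F \ G)) := by
  intro n
  induction n with
  | zero =>
    intro K hKf hK0 hKI F hF hFI h
    obtain rfl := (Set.ncard_eq_zero hKf).1 hK0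
    exact ⟨∅, by simp, by simp, by simp, by simpa using h⟩
  | succ n ih =>
    intro K hKf hKn hKI F hF hFI h
    rcases aug_core hX hI hF hKI hFI h h2 with h | ⟨a, ha, h⟩ | ⟨a, ha, f, hf, h⟩
    · exact ⟨∅, by simp, by simp, by simp, by simpa using h⟩
    · have hc : (K \ {a}).ncard = n := by
        rw [Set.ncard_sdiff_singleton_of_mem ha, hKn]; rfl
      obtain ⟨G, g1, g2, g3, g4⟩ := ih (K \ {a}) hKf.sdiff hc (Set.sdiff_subset.trans hKI) F hF hFI
        (h.mono (by
          rintro v (⟨hv, hvK⟩ | hv)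
          · by_cases hva : v = a
            · exact Or.inl hva
            · exact Or.inr (Or.inl ⟨hv, fun hk => hvK ⟨hk, hva⟩⟩)
          · exact Or.inr (Or.inr hv)))
      exact ⟨G, g1, g2, by omega, g4⟩
    · have hc : (K \ {a}).ncard = n := by
        rw [Set.ncard_sdiff_singleton_of_mem ha, hKn]; rfl
      obtain ⟨G, g1, g2, g3, g4⟩ := ih (K \ {a}) hKf.sdiff hc (Set.sdiff_subset.trans hKI) (F \ {f})
        (Set.sdiff_subset.trans hF) (fun v hv => hFI v hv.1)
        (h.mono (by
          rintro v (⟨hv, hvK⟩ | hv)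
          · by_cases hva : v = a
            · exact Or.inl hva
            · exact Or.inr ⟨Or.inl ⟨hv, fun hk => hvK ⟨hk, hva⟩⟩, fun e => hFI f hf (e ▸ hv)⟩
          · exact Or.inr ⟨Or.inr hv.1, hv.2⟩))
      refine ⟨insert f G, Set.insert_subset hf (g1.trans Set.sdiff_subset), g2.insert f,
        (Set.ncard_insert_le f G).trans (by omega), g4.mono ?_⟩
      rintro v (hv | ⟨hv, hvG⟩)
      · exact Or.inl hv
      · exact Or.inr ⟨⟨hv, fun e => hvG (Or.inl e)⟩, fun hg => hvG (Or.inr hg)⟩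

end

/-- A hereditary property with bounded deficiency holds off a finite set. -/
lemma bounded_deficiency (p : Set V → Prop) (hp : ∀ A B, A ⊆ B → p B → p A) (U : Set V) :
    ∀ B : ℕ, (∀ F : Set V, F.Finite → F ⊆ U → ∃ G ⊆ F, G.ncard ≤ B ∧ p (F \ G)) →
      ∃ F₁ ⊆ U, F₁.Finite ∧ ∀ F : Set V, F.Finite → F ⊆ U \ F₁ → p F := by
  intro B
  induction B with
  | zero =>
    intro h
    refine ⟨∅, by simp, by simp, fun F hF hFU => ?_⟩
    obtain ⟨G, g1, g2, g3⟩ := h F hF (by simpa using hFU)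
    obtain rfl := (Set.ncard_eq_zero (hF.subset g1)).1 (by omega)
    simpa using g3
  | succ B ih =>
    intro h
    by_cases hB : ∀ F : Set V, F.Finite → F ⊆ U → ∃ G ⊆ F, G.ncard ≤ B ∧ p (F \ G)
    · exact ih hB
    push Not at hB
    obtain ⟨S, hSf, hSU, hS⟩ := hB
    refine ⟨S, hSU, hSf, fun F hF hFU => ?_⟩
    obtain ⟨G, g1, g2, g3⟩ := h (F ∪ S) (hF.union hSf)
      (Set.union_subset (hFU.trans Set.sdiff_subset) hSU)
    have hGf : G.Finite := (hF.union hSf).subset g1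
    have hc : B < (G ∩ S).ncard := by
      by_contra hle
      refine hS (G ∩ S) Set.inter_subset_right (by omega) (hp _ _ ?_ g3)
      rintro v ⟨hv, hvG⟩
      exact ⟨Or.inr hv, fun hg => hvG ⟨hg, hv⟩⟩
    have hGS : G ∩ S = G := Set.eq_of_subset_of_ncard_le Set.inter_subset_left (by omega) hGf
    refine hp _ _ ?_ g3
    intro v hv
    refine ⟨Or.inl hv, fun hg => (hFU hv).2 ?_⟩
    rw [← hGS] at hg
    exact hg.2

section
variable {E : Set (V × V)}

lemma dp_edge (p : Dipath E) {i : ℕ} {v w : V} (h1 : p.verts[i]? = some v)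
    (h2 : p.verts[i+1]? = some w) : (v, w) ∈ E := by
  obtain ⟨a1, rfl⟩ := List.getElem?_eq_some_iff.1 h1
  obtain ⟨a2, rfl⟩ := List.getElem?_eq_some_iff.1 h2
  have hc : List.IsChain (fun a b => (a, b) ∈ E) p.verts := p.chain
  exact List.isChain_iff_getElem.1 hc i a2

lemma dp_idx (p : Dipath E) {i j : ℕ} {v : V} (h1 : p.verts[i]? = some v)
    (h2 : p.verts[j]? = some v) : i = j := by
  obtain ⟨a1, rfl⟩ := List.getElem?_eq_some_iff.1 h1
  obtain ⟨a2, h⟩ := List.getElem?_eq_some_iff.1 h2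
  exact (p.nodup.getElem_inj_iff.1 h).symm

lemma dp_mem (p : Dipath E) {v : V} : v ∈ p.support ↔ ∃ i : ℕ, p.verts[i]? = some v :=
  List.mem_iff_getElem?

lemma dp_last (p : Dipath E) {i : ℕ} {v : V} (h1 : p.verts[i]? = some v)
    (h2 : p.verts[i+1]? = none) : v = p.last := by
  obtain ⟨a1, rfl⟩ := List.getElem?_eq_some_iff.1 h1
  rw [List.getElem?_eq_none_iff] at h2
  have hne : p.verts ≠ [] := List.cons_ne_nil _ _
  have hl : p.last = p.verts.getLast hne := rfl
  rw [hl, List.getLast_eq_getElem]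
  congr 1
  omega

/-- Deleting a vertex set. -/
def Del (E : Set (V × V)) (Z : Set V) : Set (V × V) := {e | e ∈ E ∧ e.1 ∉ Z ∧ e.2 ∉ Z}

/-- A system of disjoint paths into `Y` avoiding `Z`. -/
def Sys (Y Z : Set V) (P : Set (Dipath E)) : Prop :=
  (∀ p ∈ P, p.last ∈ Y ∧ Disjoint p.support Z) ∧
    P.Pairwise fun p q => Disjoint p.support q.support

lemma Sys.eq {Y Z : Set V} {P : Set (Dipath E)} (h : Sys Y Z P) {p q : Dipath E} (hp : p ∈ P)
    (hq : q ∈ P) {v : V} (h1 : v ∈ p.support) (h2 : v ∈ q.support) : p = q := by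
  by_contra hne
  exact Set.disjoint_left.1 (h.2 hp hq hne) h1 h2

lemma lk_of_sys {X Y Z : Set V} {P : Set (Dipath E)} (h : Sys Y Z P) :
    LK (Del E Z) X Y (initVerts P) := by
  classical
  let Nx : V → V → Prop := fun v w => ∃ p ∈ P, ∃ i : ℕ, p.verts[i]? = some v ∧
    p.verts[i+1]? = some w
  let s : V → V := fun v => if h : ∃ w, Nx v w then h.choose else v
  have s1 : ∀ v, (∃ w, Nx v w) → Nx v (s v) := by
    intro v hv
    have : s v = hv.choose := dif_pos hv
    rw [this]; exact hv.choose_spec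
  have s2 : ∀ v, (¬ ∃ w, Nx v w) → s v = v := fun v hv => dif_neg hv
  have hinj : ∀ v v' w, Nx v w → Nx v' w → v = v' := by
    rintro v v' w ⟨p, hp, i, h1, h2⟩ ⟨q, hq, j, h3, h4⟩
    obtain rfl := h.eq hp hq ((dp_mem p).2 ⟨_, h2⟩) ((dp_mem q).2 ⟨_, h4⟩)
    have := dp_idx p h2 h4
    obtain rfl : i = j := by omega
    exact Option.some_injective _ (h1.symm.trans h3)
  have hfun : ∀ v w w', Nx v w → Nx v w' → w = w' := by
    rintro v w w' ⟨p, hp, i, h1, h2⟩ ⟨q, hq, j, h3, h4⟩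
    obtain rfl := h.eq hp hq ((dp_mem p).2 ⟨_, h1⟩) ((dp_mem q).2 ⟨_, h3⟩)
    obtain rfl := dp_idx p h1 h3
    exact Option.some_injective _ (h2.symm.trans h4)
  have hnext : ∀ p ∈ P, ∀ (i : ℕ) v, p.verts[i]? = some v → v ∉ Y → ∃ w, Nx v w := by
    intro p hp i v hv hvY
    cases hw : p.verts[i+1]? with
    | none => exact absurd ((dp_last p hv hw) ▸ (h.1 p hp).1) hvY
    | some w => exact ⟨w, p, hp, i, hv, hw⟩
  have hend : ∀ v w, Nx v w → w ∉ Y → ∃ z, Nx w z := by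
    rintro v w ⟨p, hp, i, h1, h2⟩ hw
    exact hnext p hp _ w h2 hw
  refine ⟨s, ⟨fun v hv => ?_, fun v hv w hw e => ?_⟩, fun v hv => ?_⟩
  · by_cases hN : ∃ w, Nx v w
    · left
      obtain ⟨p, hp, i, h1, h2⟩ := s1 v hN
      have hd := Set.disjoint_left.1 (h.1 p hp).2
      exact ⟨dp_edge p h1 h2, hd ((dp_mem p).2 ⟨_, h1⟩), hd ((dp_mem p).2 ⟨_, h2⟩)⟩
    · right
      refine ⟨s2 v hN, fun hx => hN ?_⟩
      obtain ⟨p, hp, rfl⟩ := hv.2 hx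
      exact hnext p hp 0 _ rfl hv.1
  · by_cases hvN : ∃ z, Nx v z <;> by_cases hwN : ∃ z, Nx w z
    · exact hinj _ _ _ (s1 v hvN) (e ▸ s1 w hwN)
    · have := s1 v hvN
      rw [e, s2 w hwN] at this
      exact absurd (hend _ _ this hw.1) hwN
    · have := s1 w hwN
      rw [← e, s2 v hvN] at this
      exact absurd (hend _ _ this hv.1) hvN
    · rwa [s2 v hvN, s2 w hwN] at e
  · by_cases hN : ∃ w, Nx v w
    · right
      by_contra hcon
      push Not at hcon
      obtain ⟨w, p, hp, i, h1, h2⟩ := hN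
      have key : ∀ k, p.verts[i+k]? = some (s^[k] v) := by
        intro k
        induction k with
        | zero => exact h1
        | succ k ih =>
          rw [Function.iterate_succ_apply']
          have hx := s1 _ (hnext p hp _ _ ih (hcon k))
          cases hw : p.verts[i+(k+1)]? with
          | none => exact absurd ((dp_last p ih hw) ▸ (h.1 p hp).1) (hcon k)
          | some w => rw [hfun _ _ _ hx ⟨p, hp, _, ih, hw⟩]
      have := key p.verts.length
      rw [List.getElem?_eq_none (by omega)] at this
      cases this
    · exact Or.inl (s2 v hN)

lemma sys_of_lk {X Y Z O : Set V} (hX : ∀ e ∈ E, e.2 ∉ X) (hO : O ⊆ X) (hOZ : Disjoint O Z)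
    (h : LK (Del E Z) X Y O) : ∃ P : Set (Dipath E), Sys Y Z P ∧ initVerts P = O := by
  classical
  obtain ⟨s, hs, hT⟩ := h
  have hX' : ∀ e ∈ Del E Z, e.2 ∉ X := fun e he => hX e he.1
  have hex : ∀ o ∈ O, ∃ n, s^[n] o ∈ Y := by
    intro o ho
    by_contra hcon
    push Not at hcon
    exact hs.orbit_contra hX' hO ho hcon (t := s) 0 (fun _ _ => rfl)
      (hT _ ⟨hcon 0, fun _ => ho⟩)
  have hpath : ∀ o : O, ∃ p : Dipath E, p.start = o ∧ p.last ∈ Y ∧ Disjoint p.support Z ∧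
      ∀ v ∈ p.support, ∃ i, (∀ j < i, s^[j] (o : V) ∉ Y) ∧ s^[i] (o : V) = v := by
    rintro ⟨o, ho⟩
    let n := Nat.find (hex o ho)
    have hn : s^[n] o ∈ Y := Nat.find_spec (hex o ho)
    have hmin : ∀ j < n, s^[j] o ∉ Y := fun j hj => Nat.find_min (hex o ho) hj
    have hedge : ∀ i < n, (s^[i] o, s^[i+1] o) ∈ Del E Z := by
      intro i hi
      have hm := hs.iter_mem hX' ho i (fun j hj => hmin j (by omega))
      rw [Function.iterate_succ_apply']
      rcases hs.1 _ hm with h | ⟨h, _⟩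
      · exact h
      · rw [← Function.iterate_succ_apply' s] at h
        have := (hs.iter_inj hX' hO ho ho _ _ (fun k hk => hmin k (by omega))
          (fun k hk => hmin k (by omega)) h).1
        omega
    have hl : o :: (List.range n).map (fun i => s^[i+1] o) =
        (List.range (n+1)).map (fun i => s^[i] o) := by
      rw [List.range_succ_eq_map, List.map_cons, List.map_map]
      rfl
    have hchain : List.IsChain (fun a b => (a, b) ∈ E)
        (o :: (List.range n).map (fun i => s^[i+1] o)) := by
      rw [hl, List.isChain_iff_getElem]
      intro i hi
      simp only [List.length_map, List.length_range] at hi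
      simp only [List.getElem_map, List.getElem_range]
      exact (hedge i (by omega)).1
    have hnodup : (o :: (List.range n).map (fun i => s^[i+1] o)).Nodup := by
      rw [hl]
      refine List.Nodup.map_on ?_ List.nodup_range
      intro i hi j hj e
      rw [List.mem_range] at hi hj
      exact (hs.iter_inj hX' hO ho ho _ _ (fun k hk => hmin k (by omega))
          (fun k hk => hmin k (by omega)) e).1
    have hsup : ∀ v ∈ o :: (List.range n).map (fun i => s^[i+1] o), ∃ i ≤ n, s^[i] o = v := by
      intro v hv
      rw [hl, List.mem_map] at hv
      obtain ⟨i, hi, rfl⟩ := hv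
      rw [List.mem_range] at hi
      exact ⟨i, by omega, rfl⟩
    refine ⟨⟨o, (List.range n).map (fun i => s^[i+1] o), hchain, hnodup⟩, rfl, ?_, ?_, ?_⟩
    · simp only [Dipath.last, hl]
      rw [List.getLast_map]
      simpa using hn
    · rw [Set.disjoint_left]
      intro v hv
      obtain ⟨i, hi, rfl⟩ := hsup v hv
      cases i with
      | zero => exact Set.disjoint_left.1 hOZ ho
      | succ i => exact (hedge i (by omega)).2.2
    · intro v hv
      obtain ⟨i, hi, rfl⟩ := hsup v hv
      exact ⟨i, fun j hj => hmin j (by omega), rfl⟩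
  choose p p1 p2 p3 p4 using hpath
  refine ⟨Set.range p, ⟨?_, ?_⟩, ?_⟩
  · rintro _ ⟨o, rfl⟩
    exact ⟨p2 o, p3 o⟩
  · rintro _ ⟨o, rfl⟩ _ ⟨o', rfl⟩ hne
    rw [Set.disjoint_left]
    intro v hv hv'
    obtain ⟨i, hi, rfl⟩ := p4 o v hv
    obtain ⟨j, hj, e⟩ := p4 o' _ hv'
    have := (hs.iter_inj hX' hO o.2 o'.2 _ _ hi hj e.symm).2
    exact hne (by rw [Subtype.ext this])
  · ext v
    constructor
    · rintro ⟨_, ⟨o, rfl⟩, rfl⟩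
      rw [p1]; exact o.2
    · intro hv
      exact ⟨_, ⟨⟨v, hv⟩, rfl⟩, p1 _⟩

/-- Finite extendability of `C` inside `U` after deleting `Z`. -/
def FE (E : Set (V × V)) (X Y Z C U : Set V) : Prop :=
  C ⊆ U ∧ U ⊆ X ∧ Disjoint U Z ∧
    ∀ F : Set V, F.Finite → F ⊆ U \ C → LK (Del E Z) X Y (C ∪ F)

lemma support_inter {X : Set V} (hX : ∀ e ∈ E, e.2 ∉ X) (p : Dipath E) {v : V}
    (hv : v ∈ p.support) (hvX : v ∈ X) : v = p.start := by
  obtain ⟨i, hi⟩ := (dp_mem p).1 hv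
  cases i with
  | zero => exact (Option.some_injective _ hi).symm
  | succ i =>
    obtain ⟨u, hu⟩ : ∃ u, p.verts[i]? = some u := by
      obtain ⟨a, _⟩ := List.getElem?_eq_some_iff.1 hi
      exact ⟨_, List.getElem?_eq_getElem (by omega)⟩
    exact absurd hvX (hX _ (dp_edge p hu hi))

lemma FE.route {X Y Z C U : Set V} (hX : ∀ e ∈ E, e.2 ∉ X) (h : FE E X Y Z C U) {x : V}
    (hx : x ∈ C) : ∃ p : Dipath E, p.start = x ∧ p.last ∈ Y ∧ Disjoint p.support Z ∧
      ∃ F₁ : Set V, F₁.Finite ∧ x ∉ F₁ ∧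
        FE E X Y (Z ∪ p.support) (C \ {x}) ((U \ F₁) \ {x}) := by
  classical
  obtain ⟨hCU, hUX, hUZ, hF⟩ := h
  have hX2 : ∀ W, ∀ e ∈ Del E W, e.2 ∉ X := fun W e he => hX e he.1
  have h0 : LK (Del E Z) X Y C := by simpa using hF ∅ (by simp) (by simp)
  obtain ⟨P, hP, hPi⟩ := sys_of_lk hX (hCU.trans hUX) (hUZ.mono_left hCU) h0
  have hx' := hx
  rw [← hPi] at hx'
  obtain ⟨p, hp, rfl⟩ := hx'
  have hpst : p.start ∈ p.support := (dp_mem p).2 ⟨0, rfl⟩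
  have hpfin : p.support.Finite := List.finite_toSet p.verts
  set W := Z ∪ p.support with hW
  have hC1 : LK (Del E W) X Y (C \ {p.start}) := by
    have hS : Sys Y W (P \ {p}) := by
      refine ⟨fun q hq => ⟨(hP.1 q hq.1).1, ?_⟩, hP.2.mono Set.sdiff_subset⟩
      rw [hW, Set.disjoint_union_right]
      exact ⟨(hP.1 q hq.1).2, hP.2 hq.1 hp hq.2⟩
    refine (lk_of_sys hS).mono ?_
    rintro v ⟨hv, hvx⟩
    rw [← hPi] at hv
    obtain ⟨q, hq, rfl⟩ := hv
    exact ⟨q, ⟨hq, fun e => hvx (by rw [e]; rfl)⟩, rfl⟩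
  have hdef : ∀ F : Set V, F.Finite → F ⊆ U \ C → ∃ G ⊆ F,
      G.ncard ≤ p.support.ncard + p.support.ncard ∧
        LK (Del E W) X Y (C \ {p.start} ∪ (F \ G)) := by
    intro F hFf hFU
    have hCF : C ∪ F ⊆ U := Set.union_subset hCU (hFU.trans Set.sdiff_subset)
    obtain ⟨Q, hQ, hQi⟩ := sys_of_lk hX (hCF.trans hUX) (hUZ.mono_left hCF) (hF F hFf hFU)
    let K : Set V := {v | ∃ q ∈ Q, q.start = v ∧ ∃ z ∈ p.support, z ∈ q.support}
    have hKc : ∃ g : V → V, Set.MapsTo g K p.support ∧ Set.InjOn g K := by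
      have : ∀ v : V, ∃ z, v ∈ K → ∃ q ∈ Q, q.start = v ∧ z ∈ p.support ∧ z ∈ q.support := by
        intro v
        by_cases hv : v ∈ K
        · obtain ⟨q, a, b, z, c, d⟩ := hv
          exact ⟨z, fun _ => ⟨q, a, b, c, d⟩⟩
        · exact ⟨v, fun h => absurd h hv⟩
      choose g hg using this
      refine ⟨g, fun v hv => ?_, fun v hv w hw e => ?_⟩
      · obtain ⟨q, _, _, h, _⟩ := hg v hv
        exact h
      · obtain ⟨q, a, b, _, d⟩ := hg v hv
        obtain ⟨q', a', b', _, d'⟩ := hg w hw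
        rw [← b, ← b', hQ.eq a a' d (e ▸ d')]
    obtain ⟨g, hg1, hg2⟩ := hKc
    have hKf : K.Finite := Set.Finite.of_injOn hg1 hg2 hpfin
    have hKn : K.ncard ≤ p.support.ncard := Set.ncard_le_ncard_of_injOn g hg1 hg2 hpfin
    have hxK : p.start ∈ K := by
      have : p.start ∈ initVerts Q := by rw [hQi]; exact Or.inl hx
      obtain ⟨q, hq, e⟩ := this
      exact ⟨q, hq, e, _, hpst, (dp_mem q).2 ⟨0, by rw [← e]; rfl⟩⟩
    have hQ' : LK (Del E W) X Y ((C ∪ F) \ K) := by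
      have hS : Sys Y W {q ∈ Q | q.start ∉ K} := by
        refine ⟨fun q hq => ⟨(hQ.1 q hq.1).1, ?_⟩, hQ.2.mono fun q hq => hq.1⟩
        rw [hW, Set.disjoint_union_right]
        refine ⟨(hQ.1 q hq.1).2, ?_⟩
        rw [Set.disjoint_left]
        exact fun z hz hz' => hq.2 ⟨q, hq.1, rfl, z, hz', hz⟩
      refine (lk_of_sys hS).mono ?_
      rintro v ⟨hv, hvK⟩
      rw [← hQi] at hv
      obtain ⟨q, hq, rfl⟩ := hv
      exact ⟨q, ⟨hq, hvK⟩, rfl⟩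
    obtain ⟨G, g1, g2, g3, g4⟩ := exchange (hX2 W)
      (Set.sdiff_subset.trans (hCU.trans hUX) : C \ {p.start} ⊆ X) hC1 _ (K ∩ (C \ {p.start}))
      (hKf.inter_of_left _) rfl Set.inter_subset_right (F \ K)
      (Set.sdiff_subset.trans ((hFU.trans Set.sdiff_subset).trans hUX))
      (fun f hf hfC => (hFU hf.1).2 hfC.1) (hQ'.mono (by
        rintro v (⟨hv, hvK⟩ | hv)
        · exact ⟨Or.inl hv.1, fun hk => hvK ⟨hk, hv⟩⟩
        · exact ⟨Or.inr hv.1, hv.2⟩))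
    refine ⟨(F ∩ K) ∪ G, Set.union_subset Set.inter_subset_left (g1.trans Set.sdiff_subset),
      (Set.ncard_union_le _ _).trans (add_le_add ?_ ?_), g4.mono ?_⟩
    · exact (Set.ncard_le_ncard Set.inter_subset_right hKf).trans hKn
    · exact g3.trans ((Set.ncard_le_ncard Set.inter_subset_left hKf).trans hKn)
    · rintro v (hv | ⟨hv, hvG⟩)
      · exact Or.inl hv
      · exact Or.inr ⟨⟨hv, fun hk => hvG (Or.inl ⟨hv, hk⟩)⟩, fun hg => hvG (Or.inr hg)⟩
  obtain ⟨F₁, hF₁U, hF₁f, hF₁⟩ := bounded_deficiency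
    (fun F => LK (Del E W) X Y (C \ {p.start} ∪ F))
    (fun A B hAB hB => hB.mono (Set.union_subset_union_right _ hAB)) (U \ C) _ hdef
  refine ⟨p, rfl, (hP.1 p hp).1, (hP.1 p hp).2, F₁, hF₁f, fun h => (hF₁U h).2 hx, ?_, ?_, ?_, ?_⟩
  · rintro v ⟨hv, hvx⟩
    exact ⟨⟨hCU hv, fun h => (hF₁U h).2 hv⟩, hvx⟩
  · exact fun v hv => hUX hv.1.1
  · rw [Set.disjoint_union_right]
    refine ⟨hUZ.mono_left fun v hv => hv.1.1, ?_⟩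
    rw [Set.disjoint_left]
    exact fun v hv hvp => hv.2 (support_inter hX p hvp (hUX hv.1.1))
  · intro F hFf hFs
    refine hF₁ F hFf fun v hv => ?_
    obtain ⟨⟨⟨a, b⟩, c⟩, d⟩ := hFs hv
    exact ⟨⟨a, fun hC => d ⟨hC, c⟩⟩, b⟩

lemma FE.add {X Y Z C U : Set V} (h : FE E X Y Z C U) {v : V} (hv : v ∈ U) :
    FE E X Y Z (insert v C) U := by
  obtain ⟨hCU, hUX, hUZ, hF⟩ := h
  refine ⟨Set.insert_subset hv hCU, hUX, hUZ, fun F hFf hFU => ?_⟩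
  by_cases hvC : v ∈ C
  · rw [Set.insert_eq_of_mem hvC] at hFU ⊢
    exact hF F hFf hFU
  · refine (hF (insert v F) (hFf.insert v) ?_).mono ?_
    · rintro w (rfl | hw)
      · exact ⟨hv, hvC⟩
      · exact ⟨(hFU hw).1, fun h => (hFU hw).2 (Or.inr h)⟩
    · rintro w ((rfl | hw) | hw)
      · exact Or.inr (Or.inl rfl)
      · exact Or.inl hw
      · exact Or.inr (Or.inr hw)

/-- States of the construction. -/
def Good (X Y X' : Set V) (Vfam : ℕ → Set V) (P : Set (Dipath E)) : Prop :=
  Sys Y ∅ P ∧ initVerts P ⊆ X ∧ ∃ U, FE E X Y (⋃ p ∈ P, p.support) (X' \ initVerts P) U ∧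
    ∀ i, ((Vfam i ∩ U) \ X').Infinite

lemma Good.step {X Y X' : Set V} {Vfam : ℕ → Set V} (hX : ∀ e ∈ E, e.2 ∉ X)
    {P : Set (Dipath E)} (hS : Sys Y ∅ P) (hi : initVerts P ⊆ X) {U : Set V}
    (hU : FE E X Y (⋃ p ∈ P, p.support) (X' \ initVerts P) U)
    (hinf : ∀ i, ((Vfam i ∩ U) \ X').Infinite) {x : V} (hxU : x ∈ U) :
    ∃ P', Good X Y X' Vfam P' ∧ P ⊆ P' ∧ x ∈ initVerts P' := by
  obtain ⟨p, rfl, p2, p3, F₁, f1, f2, f3⟩ := (hU.add hxU).route hX (Set.mem_insert x _)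
  have hp3 : ∀ q ∈ P, Disjoint p.support q.support := fun q hq =>
    p3.mono_right (Set.subset_biUnion_of_mem (u := fun p : Dipath E => p.support) hq)
  have hini : initVerts (insert p P) = insert p.start (initVerts P) := Set.image_insert_eq ..
  refine ⟨insert p P, ⟨⟨?_, ?_⟩, ?_, (U \ F₁) \ {p.start}, ?_, ?_⟩,
    Set.subset_insert _ _, ⟨p, Set.mem_insert _ _, rfl⟩⟩
  · rintro q (rfl | hq)
    · exact ⟨p2, Set.disjoint_empty _⟩
    · exact hS.1 q hq
  · rintro q (rfl | hq) q' (rfl | hq') hne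
    · exact absurd rfl hne
    · exact hp3 q' hq'
    · exact (hp3 q hq).symm
    · exact hS.2 hq hq' hne
  · rw [hini]
    exact Set.insert_subset (hU.2.1 hxU) hi
  · have e1 : (⋃ q ∈ insert p P, q.support) = (⋃ q ∈ P, q.support) ∪ p.support := by
      rw [Set.biUnion_insert, Set.union_comm]
    have e2 : X' \ initVerts (insert p P) = insert p.start (X' \ initVerts P) \ {p.start} := by
      rw [hini]
      ext v
      simp only [Set.mem_sdiff, Set.mem_insert_iff, Set.mem_singleton_iff]
      tauto
    rw [e1, e2]
    exact f3
  · intro i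
    refine ((hinf i).sdiff (f1.insert p.start)).mono ?_
    rintro v ⟨⟨⟨a, b⟩, c⟩, d⟩
    exact ⟨⟨a, ⟨b, fun h => d (Or.inr h)⟩, fun h => d (Or.inl h)⟩, c⟩
end

end FlameLink

/-- If a countable `X' ⊆ X` is `(X,Y)`-finitely extendable, then for every countable
family of infinite subsets of `X \ X'` there is a joinable `O` with `X' ⊆ O ⊆ X`
meeting all of them. -/
theorem stmt9 {V : Type u} (E : Set (V × V)) (X Y : Set V)
    (hX : ∀ e ∈ E, e.2 ∉ X) (hY : ∀ e ∈ E, e.1 ∉ Y)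
    (X' : Set V) (hcount : X'.Countable) (hfe : FinExtendable E X Y X')
    (Vfam : ℕ → Set V)
    (hfam : ∀ i, Vfam i ⊆ X \ X' ∧ (Vfam i).Infinite) :
    ∃ O : Set V, X' ⊆ O ∧ O ⊆ X ∧ Joinable E O Y ∧
      ∀ i, (O ∩ Vfam i).Nonempty := by
  classical
  have hDel : FlameLink.Del E (∅ : Set V) = E := by
    ext e; simp [FlameLink.Del]
  have hgood0 : FlameLink.Good (E := E) X Y X' Vfam ∅ := by
    refine ⟨⟨by simp, by simp⟩, by simp [initVerts], X, ⟨?_, subset_rfl, by simp, ?_⟩, ?_⟩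
    · exact Set.sdiff_subset.trans hfe.1
    · intro F hF hFX
      have e : X' \ initVerts (∅ : Set (Dipath E)) = X' := by simp [initVerts]
      rw [e] at hFX ⊢
      have hj := hfe.2 (X' ∪ F) Set.subset_union_left
        (Set.union_subset hfe.1 (hFX.trans Set.sdiff_subset))
        (hF.subset fun v hv => hv.1.resolve_left hv.2)
      obtain ⟨P, ⟨hP1, hP2⟩, hP3⟩ := hj
      have hS : FlameLink.Sys Y ∅ P := ⟨fun p hp => ⟨(hP1 p hp).2.1, Set.disjoint_empty _⟩, hP2⟩
      have := FlameLink.lk_of_sys (X := X) hS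
      rw [hP3] at this
      simpa using this
    · intro i
      refine (hfam i).2.mono fun v hv => ?_
      exact ⟨⟨hv, ((hfam i).1 hv).1⟩, ((hfam i).1 hv).2⟩
  let S := {P : Set (Dipath E) // FlameLink.Good X Y X' Vfam P}
  have hc1 : ∀ x ∈ X', IsCofinal {P : S | x ∈ initVerts P.1} := by
    rintro x hx ⟨P, hP⟩
    by_cases hxP : x ∈ initVerts P
    · exact ⟨⟨P, hP⟩, hxP, le_rfl⟩
    obtain ⟨hS, hi, U, hU, hinf⟩ := hP
    obtain ⟨P', h1, h2, h3⟩ := FlameLink.Good.step hX hS hi hU hinf (hU.1 ⟨hx, hxP⟩)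
    exact ⟨⟨P', h1⟩, h3, h2⟩
  have hc2 : ∀ i, IsCofinal {P : S | (initVerts P.1 ∩ Vfam i).Nonempty} := by
    rintro i ⟨P, hS, hi, U, hU, hinf⟩
    obtain ⟨x, ⟨hx, hxU⟩, -⟩ := (hinf i).nonempty
    obtain ⟨P', h1, h2, h3⟩ := FlameLink.Good.step hX hS hi hU hinf hxU
    exact ⟨⟨P', h1⟩, ⟨x, h3, hx⟩, h2⟩
  have : Encodable X' := hcount.toEncodable
  let D : X' ⊕ ℕ → Order.Cofinal S := fun z => match z with
    | Sum.inl x => ⟨_, hc1 x x.2⟩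
    | Sum.inr i => ⟨_, hc2 i⟩
  let q : ℕ → S := Order.sequenceOfCofinals (⟨∅, hgood0⟩ : S) D
  have hq : Monotone q := Order.sequenceOfCofinals.monotone _ _
  have hqm : ∀ z, q (Encodable.encode z + 1) ∈ D z := Order.sequenceOfCofinals.encode_mem _ _
  let P : Set (Dipath E) := ⋃ n, (q n).1
  have hsub : ∀ n, initVerts (q n).1 ⊆ initVerts P := fun n =>
    Set.image_mono (Set.subset_iUnion (fun n => (q n).1) n)
  have hOX : initVerts P ⊆ X := by
    rintro _ ⟨p, hp, rfl⟩
    obtain ⟨n, hn⟩ := Set.mem_iUnion.1 hp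
    exact (q n).2.2.1 ⟨p, hn, rfl⟩
  refine ⟨initVerts P, fun x hx => ?_, hOX, ⟨P, ⟨fun p hp => ?_, fun p hp p' hp' hne => ?_⟩, rfl⟩,
    fun i => ?_⟩
  · exact hsub _ (hqm (Sum.inl ⟨x, hx⟩))
  · obtain ⟨n, hn⟩ := Set.mem_iUnion.1 hp
    refine ⟨⟨p, hp, rfl⟩, ((q n).2.1.1 p hn).1, fun w hw => ?_⟩
    have hwm : w ∈ p.rest.dropLast := hw
    obtain ⟨i, hi⟩ := List.mem_iff_getElem?.1 hwm
    have hi2 : i < p.rest.length - 1 := by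
      obtain ⟨a, _⟩ := List.getElem?_eq_some_iff.1 hi
      simpa using a
    have h1 : p.verts[i+1]? = some w := by
      rw [List.getElem?_dropLast, if_pos hi2] at hi
      simpa [Dipath.verts] using hi
    obtain ⟨u, hu⟩ : ∃ u, p.verts[i]? = some u :=
      ⟨_, List.getElem?_eq_getElem (by simp [Dipath.verts]; omega)⟩
    obtain ⟨z, hz⟩ : ∃ z, p.verts[i+1+1]? = some z :=
      ⟨_, List.getElem?_eq_getElem (by simp [Dipath.verts]; omega)⟩
    rintro (hwX | hwY)
    · exact hX _ (FlameLink.dp_edge p hu h1) (hOX hwX)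
    · exact hY _ (FlameLink.dp_edge p h1 hz) hwY
  · obtain ⟨n, hn⟩ := Set.mem_iUnion.1 hp
    obtain ⟨m, hm⟩ := Set.mem_iUnion.1 hp'
    exact (q (max n m)).2.1.2 (hq (le_max_left n m) hn) (hq (le_max_right n m) hm) hne
  · exact (hqm (Sum.inr i)).mono (Set.inter_subset_inter_left _ (hsub _))
end

section
/- Let D be a rooted digraph with root r, w ≠ r a vertex, and let I ∈ 𝒢_D(w) be such that J ∈ 𝒢_D(w) for every J with I ⊆ J ⊆ in_D(w) and J\I finite. Then for every countable family 𝓘 of infinite subsets of in_D(w)\I, there exists I₀* ∈ 𝒢_D(w) with I ⊆ I₀* such that I₀* intersects every member of 𝓘. -/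
/-!  Common framework: digraphs as edge sets on a vertex type, directed paths,
path-systems, separations, flames and largeness. -/

universe u

variable {V : Type u}

structure Lk_s10 {V : Type u} (G : V → V → Prop) (Y C A : Set V) (p : V → ℕ → V) (l : V → ℕ) : Prop where
  start : ∀ a ∈ A, p a 0 = a
  edge : ∀ a ∈ A, ∀ i < l a, G (p a i) (p a (i+1))
  fin : ∀ a ∈ A, p a (l a) ∈ Y
  trunc : ∀ a ∈ A, ∀ i < l a, p a i ∉ Y
  mem : ∀ a ∈ A, ∀ i ≤ l a, p a i ∈ C
  inj : ∀ a ∈ A, ∀ b ∈ A, ∀ i ≤ l a, ∀ j ≤ l b, p a i = p b j → a = b ∧ i = j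

def Jn {V : Type u} (G : V → V → Prop) (Y C A : Set V) : Prop := ∃ p l, Lk_s10 G Y C A p l

theorem Lk_s10.mono {V : Type u} {G : V → V → Prop} {Y C A B : Set V} {p : V → ℕ → V} {l : V → ℕ}
    (h : Lk_s10 G Y C A p l) (hB : B ⊆ A) : Lk_s10 G Y C B p l where
  start a ha := h.start a (hB ha)
  edge a ha := h.edge a (hB ha)
  fin a ha := h.fin a (hB ha)
  trunc a ha := h.trunc a (hB ha)
  mem a ha := h.mem a (hB ha)
  inj a ha b hb := h.inj a (hB ha) b (hB hb)

theorem Jn.mono {V : Type u} {G : V → V → Prop} {Y C A B : Set V}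
    (h : Jn G Y C A) (hB : B ⊆ A) : Jn G Y C B := by
  obtain ⟨p, l, h⟩ := h
  exact ⟨p, l, h.mono hB⟩

/-- One round of the deferred-acceptance process. -/
def stp {V : Type u} (A B : Set V) (p q : V → ℕ → V) (l m : V → ℕ) (S : Set V) : Set V :=
  {v | (∃ b ∈ B, (b ∉ A ∨ ∃ i ≤ l b, p b i ∈ S) ∧ v = q b 0) ∨
    (∃ b ∈ B, ∃ j < m b, q b j ∈ S ∧ v = q b (j+1) ∧
      ∀ a ∈ A, ∀ i ≤ l a, q b j = p a i → ∃ i' , i < i' ∧ i' ≤ l a ∧ p a i' ∈ S)}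

def stg {V : Type u} (A B : Set V) (p q : V → ℕ → V) (l m : V → ℕ) : ℕ → Set V
  | 0 => ∅
  | n+1 => stp A B p q l m (stg A B p q l m n)

theorem stp_mono {V : Type u} (A B : Set V) (p q : V → ℕ → V) (l m : V → ℕ) {S T : Set V}
    (h : S ⊆ T) : stp A B p q l m S ⊆ stp A B p q l m T := by
  rintro v (⟨b, hb, h1, rfl⟩ | ⟨b, hb, j, hj, h1, rfl, h2⟩)
  · refine Or.inl ⟨b, hb, ?_, rfl⟩
    rcases h1 with h1 | ⟨i, hi, h1⟩
    · exact Or.inl h1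
    · exact Or.inr ⟨i, hi, h h1⟩
  · refine Or.inr ⟨b, hb, j, hj, h h1, rfl, ?_⟩
    intro a ha i hi he
    obtain ⟨i', h3, h4, h5⟩ := h2 a ha i hi he
    exact ⟨i', h3, h4, h h5⟩

theorem stg_succ {V : Type u} (A B : Set V) (p q : V → ℕ → V) (l m : V → ℕ) (n : ℕ) :
    stg A B p q l m n ⊆ stg A B p q l m (n+1) := by
  induction n with
  | zero => exact Set.empty_subset _
  | succ n ih => exact stp_mono _ _ _ _ _ _ ih

theorem stg_mono {V : Type u} (A B : Set V) (p q : V → ℕ → V) (l m : V → ℕ) :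
    Monotone (stg A B p q l m) := monotone_nat_of_le_succ (stg_succ A B p q l m)

theorem exchange_s10 {V : Type u} {G : V → V → Prop} {Y C A B : Set V} {p q : V → ℕ → V} {l m : V → ℕ}
    (hp : Lk_s10 G Y C A p l) (hq : Lk_s10 G Y C B q m) (hfin : (B \ A).Finite) :
    ∃ A', B ⊆ A' ∧ A' ⊆ A ∪ B ∧ Jn G Y C A' ∧ (A \ A').Finite ∧ (A \ A').ncard ≤ (B \ A).ncard := by
  classical
  set S := stg A B p q l m with hS
  have Smono : Monotone S := stg_mono A B p q l m
  have Sq : ∀ n, ∀ v ∈ S n, ∃ b ∈ B, ∃ j ≤ m b, v = q b j := by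
    intro n v hv
    cases n with
    | zero => exact absurd hv (Set.notMem_empty _)
    | succ n =>
      rcases hv with ⟨b, hb, h1, rfl⟩ | ⟨b, hb, j, hj, h1, rfl, h2⟩
      · exact ⟨b, hb, 0, Nat.zero_le _, rfl⟩
      · exact ⟨b, hb, j+1, hj, rfl⟩
  -- a reached non-initial vertex was reached through its predecessor
  have Sback : ∀ n, ∀ b ∈ B, ∀ j < m b, q b (j+1) ∈ S (n+1) → q b j ∈ S n ∧
      ∀ a ∈ A, ∀ i ≤ l a, q b j = p a i → ∃ i' , i < i' ∧ i' ≤ l a ∧ p a i' ∈ S n := by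
    intro n b hb j hj h
    rcases h with ⟨b', hb', h1, he⟩ | ⟨b', hb', j', hj', h1, he, h2⟩
    · have := (hq.inj b hb b' hb' (j+1) hj 0 (Nat.zero_le _) he).2
      omega
    · obtain ⟨rfl, h3⟩ := hq.inj b hb b' hb' (j+1) hj (j'+1) hj' he
      obtain rfl : j = j' := by omega
      exact ⟨h1, h2⟩
  have Sback0 : ∀ n, ∀ b ∈ B, q b 0 ∈ S (n+1) → b ∉ A ∨ ∃ i ≤ l b, p b i ∈ S n := by
    intro n b hb h
    rcases h with ⟨b', hb', h1, he⟩ | ⟨b', hb', j', hj', h1, he, h2⟩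
    · obtain ⟨rfl, h3⟩ := hq.inj b hb b' hb' 0 (Nat.zero_le _) 0 (Nat.zero_le _) he
      exact h1
    · have := (hq.inj b hb b' hb' 0 (Nat.zero_le _) (j'+1) hj' he).2
      omega
  have Sseg : ∀ n, ∀ b ∈ B, ∀ j ≤ m b, q b j ∈ S n → ∀ j' ≤ j, q b j' ∈ S n := by
    intro n b hb j hj h j' hj'
    induction j with
    | zero => obtain rfl : j' = 0 := by omega
              exact h
    | succ j ih =>
      rcases Nat.lt_or_ge j' (j+1) with h1 | h1
      · refine ih (by omega) ?_ (by omega)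
        cases n with
        | zero => exact absurd h (Set.notMem_empty _)
        | succ n => exact Smono (Nat.le_succ n) (Sback n b hb j hj h).1
      · obtain rfl : j' = j+1 := by omega
        exact h
  let T : ℕ → Set V := fun n => {a ∈ A | ∃ i ≤ l a, p a i ∈ S n}
  let Act : ℕ → Set V := fun n => {b ∈ B | q b 0 ∈ S n}
  have Tmono : Monotone T := by
    rintro n n' h a ⟨ha, i, hi, h1⟩
    exact ⟨ha, i, hi, Smono h h1⟩
  -- holders
  have hold : ∀ n, ∀ a ∈ T n, ∃ b ∈ Act n, ∃ j ≤ m b, ∃ i ≤ l a, q b j = p a i ∧ q b j ∈ S n ∧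
      (∀ j' ≤ m b, q b j' ∈ S n → j' ≤ j) := by
    rintro n a ⟨ha, i, hi, h1⟩
    obtain ⟨i0, ⟨hi0, h0⟩, hmax⟩ : ∃ i0, (i0 ≤ l a ∧ p a i0 ∈ S n) ∧
        ∀ i', i0 < i' → i' ≤ l a → p a i' ∉ S n := by
      refine ⟨Nat.findGreatest (fun i => p a i ∈ S n) (l a), ⟨Nat.findGreatest_le _, ?_⟩, ?_⟩
      · exact Nat.findGreatest_spec (P := fun i => p a i ∈ S n) hi h1
      · intro i' h2 h3
        exact Nat.findGreatest_is_greatest h2 h3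
    obtain ⟨b, hb, j, hj, he⟩ := Sq n _ h0
    refine ⟨b, ⟨hb, Sseg n b hb j hj (he ▸ h0) 0 (Nat.zero_le _)⟩, j, hj, i0, hi0, he.symm, he ▸ h0, ?_⟩
    intro j' hj' h2
    by_contra hlt
    have h3 := Sseg n b hb j' hj' h2 (j+1) (by omega)
    cases n with
    | zero => exact absurd h3 (Set.notMem_empty _)
    | succ n =>
      obtain ⟨i', h4, h5, h6⟩ := (Sback n b hb j (by omega) h3).2 a ha i0 hi0 he.symm
      exact hmax i' h4 h5 (Smono (Nat.le_succ n) h6)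
  have holdinj : ∀ n, ∃ g : V → V, Set.MapsTo g (T n) (Act n) ∧ Set.InjOn g (T n) := by
    intro n
    choose! g hg j hj i hi he hs hm using hold n
    refine ⟨g, hg, ?_⟩
    intro a ha a' ha' hgg
    have e1 : j a = j a' := by
      apply le_antisymm
      · exact hm a' ha' _ (hgg ▸ hj a ha) (hgg ▸ hs a ha)
      · exact hm a ha _ (hgg ▸ hj a' ha') (hgg ▸ hs a' ha')
    have e2 : p a (i a) = p a' (i a') := by
      rw [← he a ha, ← he a' ha', hgg, e1]
    exact (hp.inj a ha.1 a' ha'.1 _ (hi a ha) _ (hi a' ha') e2).1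
  have ActSub : ∀ n, Act n ⊆ (B \ A) ∪ (B ∩ T n) := by
    rintro n b ⟨hb, h⟩
    cases n with
    | zero => exact absurd h (Set.notMem_empty _)
    | succ n =>
      by_cases hbA : b ∈ A
      · rcases Sback0 n b hb h with h1 | ⟨i, hi, h1⟩
        · exact absurd hbA h1
        · exact Or.inr ⟨hb, hbA, i, hi, Smono (Nat.le_succ n) h1⟩
      · exact Or.inl ⟨hb, hbA⟩
  have ActSub' : ∀ n, Act (n+1) ⊆ (B \ A) ∪ T n := by
    rintro n b ⟨hb, h⟩
    by_cases hbA : b ∈ A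
    · rcases Sback0 n b hb h with h1 | ⟨i, hi, h1⟩
      · exact absurd hbA h1
      · exact Or.inr ⟨hbA, i, hi, h1⟩
    · exact Or.inl ⟨hb, hbA⟩
  have Afin : ∀ n, (Act n).Finite ∧ (T n).Finite := by
    intro n
    have key : (Act n).Finite → (T n).Finite := by
      intro h
      obtain ⟨g, hg, hgi⟩ := holdinj n
      exact Set.Finite.of_injOn hg hgi h
    have : (Act n).Finite := by
      induction n with
      | zero =>
        refine Set.Finite.subset Set.finite_empty ?_
        rintro b ⟨_, h⟩
        exact h
      | succ n ih =>
        have h2 : (T n).Finite := by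
          obtain ⟨g, hg, hgi⟩ := holdinj n
          refine Set.Finite.of_injOn hg hgi (ih ?_)
          intro h
          exact Set.Finite.of_injOn hg hgi h
        exact (hfin.union h2).subset (ActSub' n)
    exact ⟨this, key this⟩
  have Tcard : ∀ n, (T n \ B).ncard ≤ (B \ A).ncard := by
    intro n
    obtain ⟨g, hg, hgi⟩ := holdinj n
    have h1 : (T n).ncard ≤ (Act n).ncard := Set.ncard_le_ncard_of_injOn g hg hgi (Afin n).1
    have h2 : (Act n).ncard ≤ (B \ A).ncard + (B ∩ T n).ncard :=
      (Set.ncard_le_ncard (ActSub n) (hfin.union ((Afin n).2.subset Set.inter_subset_right))).trans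
        (Set.ncard_union_le _ _)
    have h3 := Set.ncard_inter_add_ncard_diff_eq_ncard (T n) B (Afin n).2
    rw [Set.inter_comm] at h3
    omega
  -- the limit
  let Sw : Set V := ⋃ n, S n
  let Tw : Set V := ⋃ n, T n
  have hTw : ∀ a ∈ A, ∀ i ≤ l a, p a i ∈ Sw → a ∈ Tw := by
    intro a ha i hi h
    obtain ⟨n, hn⟩ := Set.mem_iUnion.1 h
    exact Set.mem_iUnion.2 ⟨n, ha, i, hi, hn⟩
  have cl0 : ∀ b ∈ B, (b ∉ A ∨ b ∈ Tw) → q b 0 ∈ Sw := by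
    intro b hb h
    rcases h with h | h
    · exact Set.mem_iUnion.2 ⟨1, Or.inl ⟨b, hb, Or.inl h, rfl⟩⟩
    · obtain ⟨n, hn⟩ := Set.mem_iUnion.1 h
      exact Set.mem_iUnion.2 ⟨n+1, Or.inl ⟨b, hb, Or.inr hn.2, rfl⟩⟩
  have cl1 : ∀ b ∈ B, ∀ j < m b, q b j ∈ Sw →
      (∀ a ∈ A, ∀ i ≤ l a, q b j = p a i → ∃ i' , i < i' ∧ i' ≤ l a ∧ p a i' ∈ Sw) →
      q b (j+1) ∈ Sw := by
    intro b hb j hj h h2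
    obtain ⟨n, hn⟩ := Set.mem_iUnion.1 h
    by_cases hex : ∃ a ∈ A, ∃ i ≤ l a, q b j = p a i
    · obtain ⟨a, ha, i, hi, he⟩ := hex
      obtain ⟨i', h3, h4, h5⟩ := h2 a ha i hi he
      obtain ⟨n', hn'⟩ := Set.mem_iUnion.1 h5
      refine Set.mem_iUnion.2 ⟨max n n' + 1, Or.inr ⟨b, hb, j, hj, Smono (le_max_left _ _) hn, rfl, ?_⟩⟩
      intro a' ha' k hk he'
      obtain ⟨rfl, rfl⟩ := hp.inj a ha a' ha' i hi k hk (he.symm.trans he')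
      exact ⟨i', h3, h4, Smono (le_max_right _ _) hn'⟩
    · refine Set.mem_iUnion.2 ⟨n + 1, Or.inr ⟨b, hb, j, hj, hn, rfl, ?_⟩⟩
      intro a' ha' k hk he'
      exact absurd ⟨a', ha', k, hk, he'⟩ hex
  have segw : ∀ b ∈ B, ∀ j ≤ m b, q b j ∈ Sw → ∀ j' ≤ j, q b j' ∈ Sw := by
    intro b hb j hj h j' hj'
    obtain ⟨n, hn⟩ := Set.mem_iUnion.1 h
    exact Set.mem_iUnion.2 ⟨n, Sseg n b hb j hj hn j' hj'⟩
  have route : ∀ b, b ∈ B ∧ (b ∉ A ∨ b ∈ Tw) → ∃ (J : ℕ) (a : V) (i k : ℕ), J ≤ m b ∧ 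
      (∀ j ≤ J, q b j ∈ Sw) ∧ 
      ((k = 0 ∧ J = m b) ∨
       (a ∈ A ∧ i + k = l a ∧ q b J = p a i ∧ ∀ i', i < i' → i' ≤ l a → p a i' ∉ Sw)) := by
    rintro b ⟨hb, hact⟩
    have h0 := cl0 b hb hact
    obtain ⟨J, ⟨hJ, hJS⟩, hmax⟩ : ∃ i0, (i0 ≤ m b ∧ q b i0 ∈ Sw) ∧
        ∀ i', i0 < i' → i' ≤ m b → q b i' ∉ Sw := by
      refine ⟨Nat.findGreatest (fun i => q b i ∈ Sw) (m b), ⟨Nat.findGreatest_le _, ?_⟩, ?_⟩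
      · exact Nat.findGreatest_spec (P := fun i => q b i ∈ Sw) (Nat.zero_le _) h0
      · intro i' h2 h3
        exact Nat.findGreatest_is_greatest h2 h3
    rcases Nat.lt_or_ge J (m b) with hlt | hge
    · by_contra hcon
      refine hmax (J+1) (by omega) hlt (cl1 b hb J hlt hJS ?_)
      intro a ha i hi he
      by_contra h3
      refine hcon ⟨J, a, i, l a - i, hJ, segw b hb J hJ hJS, Or.inr ⟨ha, by omega, he, ?_⟩⟩
      intro i' h4 h5 h6
      exact h3 ⟨i', h4, h5, h6⟩
    · exact ⟨J, b, 0, 0, hJ, segw b hb J hJ hJS, Or.inl ⟨rfl, by omega⟩⟩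
  choose! J α ι κ hJ hJS hr using route
  let act : V → Prop := fun b => b ∈ B ∧ (b ∉ A ∨ b ∈ Tw)
  let p' : V → ℕ → V := fun b t =>
    if act b then (if t ≤ J b then q b t else p (α b) (ι b + (t - J b))) else p b t
  let l' : V → ℕ := fun b => if act b then J b + κ b else l b
  refine ⟨B ∪ (A \ Tw), Set.subset_union_left, ?_, ⟨p', l', ?_⟩, ?_⟩
  · rintro v (h | h)
    · exact Or.inr h
    · exact Or.inl h.1
  · have hna : ∀ b ∈ B ∪ (A \ Tw), ¬ act b → b ∈ A ∧ b ∉ Tw := by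
      rintro b (hb | hb) hn
      · simp only [act] at hn
        tauto
      · exact hb
    -- classification of the vertices of the new routes
    have cls : ∀ b, act b → ∀ t ≤ l' b, (t ≤ J b ∧ p' b t = q b t ∧ q b t ∈ Sw) ∨
        (J b < t ∧ p' b t = p (α b) (ι b + (t - J b)) ∧ ι b + (t - J b) ≤ l (α b) ∧ α b ∈ A ∧
          p (α b) (ι b + (t - J b)) ∉ Sw ∧ q b (J b) = p (α b) (ι b) ∧ 
          ι b + κ b = l (α b) ∧
          ∀ i', ι b < i' → i' ≤ l (α b) → p (α b) i' ∉ Sw) := by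
      intro b hb t ht
      simp only [l', if_pos hb] at ht
      by_cases htJ : t ≤ J b
      · left
        exact ⟨htJ, by simp [p', hb, htJ], hJS b hb t htJ⟩
      · right
        rcases hr b hb with ⟨h1, h2⟩ | ⟨h1, h2, h3, h4⟩
        · omega
        · exact ⟨by omega, by simp [p', hb, htJ], by omega, h1, h4 _ (by omega) (by omega), h3, h2, h4⟩
    have cln : ∀ b, ¬ act b → ∀ t, p' b t = p b t := by
      intro b hb t
      simp [p', hb]
    have lln : ∀ b, ¬ act b → l' b = l b := by
      intro b hb
      simp [l', hb]
    have lla : ∀ b, act b → l' b = J b + κ b := by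
      intro b hb
      simp [l', hb]
    have mix : ∀ b c, act b → c ∈ B ∪ (A \ Tw) → ¬ act c → ∀ t ≤ l' b, ∀ s ≤ l' c, p' b t ≠ p' c s := by
      intro b c hb hc hnc t ht s hs he
      obtain ⟨hcA, hcT⟩ := hna c hc hnc
      rw [cln c hnc] at he
      rw [lln c hnc] at hs
      rcases cls b hb t ht with ⟨h1, h2, h3⟩ | ⟨h1, h2, h3, h4, h5, h6, h7, h8⟩
      · rw [h2] at he
        exact hcT (hTw c hcA s hs (he ▸ h3))
      · rw [h2] at he
        obtain ⟨h9, -⟩ := hp.inj _ h4 c hcA _ h3 s hs he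
        refine hcT (h9 ▸ hTw _ h4 (ι b) (by omega) ?_)
        rw [← h6]
        exact hJS b hb _ le_rfl
    constructor
    · intro b hb
      by_cases h : act b
      · simp [p', h, hq.start b h.1]
      · rw [cln b h]
        exact hp.start b (hna b hb h).1
    · intro b hb t ht
      by_cases h : act b
      · rcases cls b h t ht.le with ⟨h1, h2, h3⟩ | ⟨h1, h2, h3, h4, h5, h6, h7, h8⟩
        · rcases cls b h (t+1) ht with ⟨k1, k2, k3⟩ | ⟨k1, k2, k3, k4, k5, k6, k7, k8⟩
          · rw [h2, k2]
            exact hq.edge b h.1 t (by have := hJ b h; omega)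
          · obtain rfl : t = J b := by omega
            rw [h2, k2, k6]
            have := hp.edge _ k4 (ι b) (by omega)
            convert this using 2
            omega
        · rcases cls b h (t+1) ht with ⟨k1, k2, k3⟩ | ⟨k1, k2, k3, k4, k5, k6, k7, k8⟩
          · omega
          · rw [h2, k2]
            have := hp.edge _ k4 (ι b + (t - J b)) (by omega)
            convert this using 2
            omega
      · rw [cln b h, cln b h]
        rw [lln b h] at ht
        exact hp.edge b (hna b hb h).1 t ht
    · intro b hb
      by_cases h : act b
      · rcases hr b h with ⟨h1, h2⟩ | ⟨h1, h2, h3, h4⟩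
        · have : p' b (l' b) = q b (m b) := by simp [p', l', h, h1, h2]
          rw [this]
          exact hq.fin b h.1
        · have : p' b (l' b) = p (α b) (l (α b)) := by
            by_cases hk : κ b = 0
            · have : ι b = l (α b) := by omega
              simp [p', l', h, hk, h3, this]
            · simp [p', l', h, hk, h2]
          rw [this]
          exact hp.fin _ h1
      · rw [cln b h, lln b h]
        exact hp.fin b (hna b hb h).1
    · intro b hb t ht
      by_cases h : act b
      · rw [lla b h] at ht
        rcases cls b h t (by rw [lla b h]; omega) with ⟨h1, h2, h3⟩ | ⟨h1, h2, h3, h4, h5, h6, h7, h8⟩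
        · rw [h2]
          rcases Nat.lt_or_ge t (J b) with h9 | h9
          · exact hq.trunc b h.1 t (by have := hJ b h; omega)
          · obtain rfl : t = J b := by omega
            rcases hr b h with ⟨k1, k2⟩ | ⟨k1, k2, k3, k4⟩
            · omega
            · rw [k3]
              exact hp.trunc _ k1 _ (by omega)
        · rw [h2]
          exact hp.trunc _ h4 _ (by omega)
      · rw [cln b h]
        rw [lln b h] at ht
        exact hp.trunc b (hna b hb h).1 t ht
    · intro b hb t ht
      by_cases h : act b
      · rcases cls b h t ht with ⟨h1, h2, h3⟩ | ⟨h1, h2, h3, h4, h5, h6, h7, h8⟩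
        · rw [h2]
          exact hq.mem b h.1 t (by have := hJ b h; omega)
        · rw [h2]
          exact hp.mem _ h4 _ (by omega)
      · rw [cln b h]
        rw [lln b h] at ht
        exact hp.mem b (hna b hb h).1 t ht
    · intro b hb c hc t ht s hs he
      by_cases h : act b
      · by_cases h' : act c
        · rcases cls b h t ht with ⟨h1, h2, h3⟩ | ⟨h1, h2, h3, h4, h5, h6, h7, h8⟩
          · rcases cls c h' s hs with ⟨k1, k2, k3⟩ | ⟨k1, k2, k3, k4, k5, k6, k7, k8⟩
            · rw [h2, k2] at he
              exact hq.inj b h.1 c h'.1 t (h1.trans (hJ b h)) s (k1.trans (hJ c h')) he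
            · rw [h2, k2] at he
              exact absurd (he ▸ h3) k5
          · rcases cls c h' s hs with ⟨k1, k2, k3⟩ | ⟨k1, k2, k3, k4, k5, k6, k7, k8⟩
            · rw [h2, k2] at he
              exact absurd (he ▸ k3) h5
            · rw [h2, k2] at he
              obtain ⟨e1, e2⟩ := hp.inj _ h4 _ k4 _ h3 _ k3 he
              have e3 : ι b = ι c := by
                rcases lt_trichotomy (ι b) (ι c) with h9 | h9 | h9
                · refine absurd ?_ (h8 (ι c) h9 (by rw [e1]; omega))
                  rw [e1, ← k6]
                  exact hJS c h' _ le_rfl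
                · exact h9
                · refine absurd ?_ (k8 (ι b) h9 (by rw [← e1]; omega))
                  rw [← e1, ← h6]
                  exact hJS b h _ le_rfl
              have e4 : q b (J b) = q c (J c) := by rw [h6, k6, e1, e3]
              obtain ⟨rfl, -⟩ := hq.inj b h.1 c h'.1 _ (hJ b h) _ (hJ c h') e4
              exact ⟨rfl, by omega⟩
        · exact absurd he (mix b c h hc h' t ht s hs)
      · by_cases h' : act c
        · exact absurd he.symm (mix c b h' hb h s hs t ht)
        · rw [cln b h, cln c h'] at he
          rw [lln b h] at ht
          rw [lln c h'] at hs
          exact hp.inj b (hna b hb h).1 c (hna c hc h').1 t ht s hs he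
  · -- counting
    have hsub : A \ (B ∪ A \ Tw) = ⋃ n, (T n \ B) := by
      ext v
      simp only [Set.mem_diff, Set.mem_union, Set.mem_iUnion, Tw]
      constructor
      · rintro ⟨h1, h2⟩
        push Not at h2
        obtain ⟨n, hn⟩ := h2.2 h1
        exact ⟨n, hn, h2.1⟩
      · rintro ⟨n, hn, h2⟩
        refine ⟨hn.1, ?_⟩
        push Not
        exact ⟨h2, fun _ => ⟨n, hn⟩⟩
    have key : ∀ F : Finset V, (F : Set V) ⊆ ⋃ n, (T n \ B) → F.card ≤ (B \ A).ncard := by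
      intro F hF
      obtain ⟨n, hn⟩ : ∃ n, (F : Set V) ⊆ T n \ B := by
        have hd : Monotone (fun n => T n \ B) := fun n n' h => Set.diff_subset_diff_left (Tmono h)
        exact Directed.exists_mem_subset_of_finset_subset_biUnion (directed_of_isDirected_le hd) hF
      rw [← Set.ncard_coe_finset]
      exact (Set.ncard_le_ncard hn ((Afin n).2.subset Set.diff_subset)).trans (Tcard n)
    have hf : (⋃ n, (T n \ B)).Finite := by
      by_contra hinf
      obtain ⟨F, hF, hc⟩ := Set.Infinite.exists_subset_card_eq hinf ((B \ A).ncard + 1)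
      have := key F hF
      omega
    rw [hsub]
    refine ⟨hf, ?_⟩
    have := key hf.toFinset (by simp)
    rwa [Set.ncard_eq_toFinset_card _ hf]

def FE {V : Type u} (G : V → V → Prop) (Y C A U : Set V) : Prop :=
  ∀ F : Finset V, (F : Set V) ⊆ U → Jn G Y C (A ∪ (F : Set V))

theorem comb {V : Type u} (Ind : Finset V → Prop) (hmono : ∀ F F', F' ⊆ F → Ind F → Ind F')
    (U : Set V) (K : ℕ)
    (h : ∀ F : Finset V, (F : Set V) ⊆ U → ∃ F' : Finset V, F' ⊆ F ∧ Ind F' ∧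
      ((F : Set V) \ (F' : Set V)).ncard ≤ K) :
    ∃ G0 : Finset V, ∀ F : Finset V, (F : Set V) ⊆ U → Disjoint F G0 → Ind F := by
  classical
  by_contra hcon
  push Not at hcon
  have key : ∀ n, ∃ F : Finset V, (F : Set V) ⊆ U ∧ ∀ F' ⊆ F, Ind F' → n ≤ (F \ F').card := by
    intro n
    induction n with
    | zero => exact ⟨∅, by simp, fun _ _ _ => Nat.zero_le _⟩
    | succ n ih =>
      obtain ⟨F, hF, hF2⟩ := ih
      obtain ⟨H, hH, hd, hH2⟩ := hcon F
      refine ⟨F ∪ H, by simp [hF, hH], ?_⟩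
      intro F' hF' hI
      have h1 := hF2 (F' ∩ F) Finset.inter_subset_right (hmono _ _ Finset.inter_subset_left hI)
      have h2 : (H \ F').Nonempty := by
        rw [Finset.nonempty_iff_ne_empty]
        intro h3
        rw [Finset.sdiff_eq_empty_iff_subset] at h3
        exact hH2 (hmono _ _ h3 hI)
      have h3 : (F \ (F' ∩ F)) ∪ (H \ F') ⊆ (F ∪ H) \ F' := by
        intro v
        simp only [Finset.mem_union, Finset.mem_sdiff, Finset.mem_inter]
        tauto
      have h4 : Disjoint (F \ (F' ∩ F)) (H \ F') :=
        Finset.disjoint_of_subset_left Finset.sdiff_subset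
          (Finset.disjoint_of_subset_right Finset.sdiff_subset hd.symm)
      have h5 := Finset.card_le_card h3
      rw [Finset.card_union_of_disjoint h4] at h5
      have := h2.card_pos
      omega
  obtain ⟨F, hF, hF2⟩ := key (K+1)
  obtain ⟨F', h1, h2, h3⟩ := h F hF
  have := hF2 F' h1 h2
  rw [← Finset.coe_sdiff, Set.ncard_coe_finset] at h3
  omega

theorem commit {V : Type u} {G : V → V → Prop} {Y C A U : Set V} (h : FE G Y C A U)
    {x : V} (hx : x ∈ A) (hd : Disjoint A U) :
    ∃ p l, Lk_s10 G Y C {x} p l ∧ ∃ G0 : Finset V,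
      FE G Y (C \ {v | ∃ i ≤ l x, v = p x i}) (A \ {x}) (U \ (G0 : Set V)) := by
  classical
  obtain ⟨q, m, hq⟩ := h ∅ (by simp)
  simp only [Finset.coe_empty, Set.union_empty] at hq
  refine ⟨q, m, hq.mono (by simpa using hx), ?_⟩
  set Q : Set V := {v | ∃ i ≤ m x, v = q x i} with hQ
  have Qfin : Q.Finite := by
    have : Q = q x '' (Set.Iic (m x)) := by
      ext v
      simp only [hQ, Set.mem_setOf_eq, Set.mem_image, Set.mem_Iic]
      constructor
      · rintro ⟨i, hi, rfl⟩
        exact ⟨i, hi, rfl⟩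
      · rintro ⟨i, hi, rfl⟩
        exact ⟨i, hi, rfl⟩
    rw [this]
    exact (Set.finite_Iic _).image _
  have hqB : Lk_s10 G Y (C \ Q) (A \ {x}) q m :=
    { start := (hq.mono Set.diff_subset).start
      edge := (hq.mono Set.diff_subset).edge
      fin := (hq.mono Set.diff_subset).fin
      trunc := (hq.mono Set.diff_subset).trunc
      inj := (hq.mono Set.diff_subset).inj
      mem := by
        rintro a ⟨ha, hax⟩ i hi
        refine ⟨hq.mem a ha i hi, ?_⟩
        rintro ⟨j, hj, he⟩
        exact hax (hq.inj a ha x hx i hi j hj he).1 }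
  obtain ⟨G0, hG0⟩ := comb (fun F => Jn G Y (C \ Q) (A \ {x} ∪ (F : Set V)))
    (fun F F' hs hI => hI.mono (Set.union_subset_union_right _ (by exact_mod_cast hs))) U
    (Q.ncard + Q.ncard) (by
      intro F hF
      obtain ⟨p, l, hp⟩ := h F hF
      let AF : Set V := {a ∈ A ∪ (F : Set V) | ∀ i ≤ l a, p a i ∉ Q}
      have hAF : AF ⊆ A ∪ (F : Set V) := fun a ha => ha.1
      have hpF : Lk_s10 G Y (C \ Q) AF p l :=
        { start := (hp.mono hAF).start
          edge := (hp.mono hAF).edge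
          fin := (hp.mono hAF).fin
          trunc := (hp.mono hAF).trunc
          inj := (hp.mono hAF).inj
          mem := fun a ha i hi => ⟨hp.mem a ha.1 i hi, ha.2 i hi⟩ }
      have hk : ∀ a ∈ (A ∪ (F : Set V)) \ AF, ∃ v ∈ Q, ∃ i ≤ l a, p a i = v := by
        rintro a ⟨ha, hna⟩
        by_contra hcon
        exact hna ⟨ha, fun i hi hm => hcon ⟨_, hm, i, hi, rfl⟩⟩
      choose! g hg i hi he using hk
      have ginj : Set.InjOn g ((A ∪ (F : Set V)) \ AF) := by
        intro a ha b hb hab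
        exact (hp.inj a ha.1 b hb.1 _ (hi a ha) _ (hi b hb)
          ((he a ha).trans (hab.trans (he b hb).symm))).1
      have kfin : ((A ∪ (F : Set V)) \ AF).Finite := Set.Finite.of_injOn (f := g) hg ginj Qfin
      have kcard : ((A ∪ (F : Set V)) \ AF).ncard ≤ Q.ncard :=
        Set.ncard_le_ncard_of_injOn g hg ginj Qfin
      have hsub : (A \ {x}) \ AF ⊆ (A ∪ (F : Set V)) \ AF := fun a ha => ⟨Or.inl ha.1.1, ha.2⟩
      obtain ⟨A', h1, h2, h3, h4, h5⟩ := exchange_s10 hpF hqB (kfin.subset hsub)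
      have h6 : (AF \ A').ncard ≤ Q.ncard :=
        h5.trans ((Set.ncard_le_ncard hsub kfin).trans kcard)
      refine ⟨F.filter (· ∈ A'), Finset.filter_subset _ _, h3.mono ?_, ?_⟩
      · apply Set.union_subset h1
        intro v hv
        simpa using (Finset.mem_filter.1 (Finset.mem_coe.1 hv)).2
      · have h7 : ((F : Set V) \ ((F.filter (· ∈ A') : Finset V) : Set V)) ⊆
            ((A ∪ (F : Set V)) \ AF) ∪ (AF \ A') := by
          rintro v ⟨hv, hv2⟩
          have hv3 : v ∉ A' := fun h8 => hv2 (by simpa using ⟨hv, h8⟩)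
          by_cases hvA : v ∈ AF
          · exact Or.inr ⟨hvA, hv3⟩
          · exact Or.inl ⟨Or.inr hv, hvA⟩
        have h8 := Set.ncard_le_ncard h7 (kfin.union h4)
        have h9 := Set.ncard_union_le ((A ∪ (F : Set V)) \ AF) (AF \ A')
        omega)
  refine ⟨G0, ?_⟩
  intro F hF
  apply hG0 F (hF.trans Set.diff_subset)
  rw [Finset.disjoint_left]
  intro v hv hv2
  exact (hF hv).2 hv2

structure St (V : Type u) where
  K : Set V
  p : V → ℕ → V
  l : V → ℕ
  C : Set V
  A : Set V
  U : Set V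

structure Good {V : Type u} (G : V → V → Prop) (Y C0 A0 U0 : Set V) (𝓐 : ℕ → Set V) (s : St V) : Prop where
  lk : Lk_s10 G Y C0 s.K s.p s.l
  off : ∀ a ∈ s.K, ∀ i ≤ s.l a, s.p a i ∉ s.C
  sub : s.C ⊆ C0
  fe : FE G Y s.C s.A s.U
  disj : Disjoint s.A s.U
  cov : A0 ⊆ s.K ∪ s.A
  asub : s.A ⊆ A0 ∪ U0
  usub : s.U ⊆ U0
  ksub : s.K ⊆ A0 ∪ U0
  inf : ∀ i, (s.U ∩ 𝓐 i).Infinite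

def StExt {V : Type u} (s t : St V) : Prop := s.K ⊆ t.K ∧ ∀ a ∈ s.K, t.p a = s.p a ∧ t.l a = s.l a

theorem StExt.trans {V : Type u} {s t v : St V} (h : StExt s t) (h' : StExt t v) : StExt s v :=
  ⟨h.1.trans h'.1, fun a ha => ⟨(h'.2 a (h.1 ha)).1.trans (h.2 a ha).1,
    (h'.2 a (h.1 ha)).2.trans (h.2 a ha).2⟩⟩

theorem StExt.refl {V : Type u} (s : St V) : StExt s s := ⟨subset_rfl, fun _ _ => ⟨rfl, rfl⟩⟩

theorem good_commit {V : Type u} {G : V → V → Prop} {Y C0 A0 U0 : Set V} {𝓐 : ℕ → Set V} {s : St V}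
    (h : Good G Y C0 A0 U0 𝓐 s) {x : V} (hx : x ∈ s.A) :
    ∃ t, Good G Y C0 A0 U0 𝓐 t ∧ StExt s t ∧ x ∈ t.K := by
  classical
  obtain ⟨q, m, hq, G0, hG0⟩ := commit h.fe hx h.disj
  have hxC : x ∈ s.C := by
    have := hq.mem x rfl 0 (Nat.zero_le _)
    rwa [hq.start x rfl] at this
  have hxK : x ∉ s.K := by
    intro hk
    have := h.off x hk 0 (Nat.zero_le _)
    rw [h.lk.start x hk] at this
    exact this hxC
  have hne : ∀ a ∈ s.K, a ≠ x := fun a ha he => hxK (he ▸ ha)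
  let p' := Function.update s.p x (q x)
  let l' := Function.update s.l x (m x)
  have pK : ∀ a ∈ s.K, p' a = s.p a := fun a ha => Function.update_of_ne (hne a ha) _ _
  have lK : ∀ a ∈ s.K, l' a = s.l a := fun a ha => Function.update_of_ne (hne a ha) _ _
  have px : p' x = q x := Function.update_self _ _ _
  have lx : l' x = m x := Function.update_self _ _ _
  have hx1 : x ∈ ({x} : Set V) := rfl
  refine ⟨⟨insert x s.K, p', l', s.C \ {v | ∃ i ≤ m x, v = q x i}, s.A \ {x}, s.U \ (G0 : Set V)⟩,
    ?_, ⟨Set.subset_insert _ _, fun a ha => ⟨pK a ha, lK a ha⟩⟩, Set.mem_insert _ _⟩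
  constructor
  · show Lk_s10 G Y C0 (insert x s.K) p' l'
    constructor
    · rintro a (rfl | ha)
      · rw [px]; exact hq.start _ hx1
      · rw [pK a ha]; exact h.lk.start a ha
    · rintro a (rfl | ha)
      · rw [px, lx]; exact hq.edge _ hx1
      · rw [pK a ha, lK a ha]; exact h.lk.edge a ha
    · rintro a (rfl | ha)
      · rw [px, lx]; exact hq.fin _ hx1
      · rw [pK a ha, lK a ha]; exact h.lk.fin a ha
    · rintro a (rfl | ha)
      · rw [px, lx]; exact hq.trunc _ hx1
      · rw [pK a ha, lK a ha]; exact h.lk.trunc a ha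
    · rintro a (rfl | ha)
      · rw [px, lx]; exact fun i hi => h.sub (hq.mem _ hx1 i hi)
      · rw [pK a ha, lK a ha]; exact h.lk.mem a ha
    · rintro a (rfl | ha) b (rfl | hb)
      · rw [px, lx]; exact hq.inj _ hx1 _ hx1
      · rw [px, lx, pK b hb, lK b hb]
        intro i hi j hj he
        exact absurd (he ▸ hq.mem _ hx1 i hi) (h.off b hb j hj)
      · rw [px, lx, pK a ha, lK a ha]
        intro i hi j hj he
        exact absurd (he ▸ hq.mem _ hx1 j hj) (h.off a ha i hi)
      · rw [pK a ha, lK a ha, pK b hb, lK b hb]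
        exact h.lk.inj a ha b hb
  · rintro a (rfl | ha)
    · simp only [px, lx]
      rintro i hi ⟨_, h2⟩
      exact h2 ⟨i, hi, rfl⟩
    · simp only [pK a ha, lK a ha]
      rintro i hi ⟨h1, _⟩
      exact h.off a ha i hi h1
  · exact Set.diff_subset.trans h.sub
  · exact hG0
  · exact Set.disjoint_of_subset Set.diff_subset Set.diff_subset h.disj
  · intro a ha
    by_cases hax : a = x
    · exact Or.inl (Or.inl hax)
    · rcases h.cov ha with h1 | h1
      · exact Or.inl (Or.inr h1)
      · exact Or.inr ⟨h1, hax⟩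
  · exact Set.diff_subset.trans h.asub
  · exact Set.diff_subset.trans h.usub
  · rintro a (rfl | ha)
    · exact h.asub hx
    · exact h.ksub ha
  · intro i
    have := (h.inf i).diff G0.finite_toSet
    refine this.mono ?_
    rintro v ⟨⟨h1, h2⟩, h3⟩
    exact ⟨⟨h1, h3⟩, h2⟩

theorem good_add {V : Type u} {G : V → V → Prop} {Y C0 A0 U0 : Set V} {𝓐 : ℕ → Set V} {s : St V}
    (h : Good G Y C0 A0 U0 𝓐 s) {x : V} (hx : x ∈ s.U) :
    ∃ t, Good G Y C0 A0 U0 𝓐 t ∧ StExt s t ∧ x ∈ t.K := by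
  classical
  have h' : Good G Y C0 A0 U0 𝓐 ⟨s.K, s.p, s.l, s.C, insert x s.A, s.U \ {x}⟩ := by
    refine ⟨h.lk, h.off, h.sub, ?_, ?_, ?_, ?_, Set.diff_subset.trans h.usub, h.ksub, ?_⟩
    · intro F hF
      have := h.fe (insert x F) (by
        intro v hv
        rcases Finset.mem_insert.1 (Finset.mem_coe.1 hv) with rfl | hv
        · exact hx
        · exact (hF hv).1)
      refine this.mono ?_
      rintro v ((rfl | hv) | hv)
      · exact Or.inr (by simp)
      · exact Or.inl hv
      · exact Or.inr (by simp at hv; simp [hv])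
    · rw [Set.disjoint_left]
      rintro v (rfl | hv) ⟨h1, h2⟩
      · exact h2 rfl
      · exact Set.disjoint_left.1 h.disj hv h1
    · exact h.cov.trans (Set.union_subset_union_right _ (Set.subset_insert _ _))
    · rintro v (rfl | hv)
      · exact Or.inr (h.usub hx)
      · exact h.asub hv
    · intro i
      refine ((h.inf i).diff (Set.finite_singleton x)).mono ?_
      rintro v ⟨⟨h1, h2⟩, h3⟩
      exact ⟨⟨h1, h3⟩, h2⟩
  obtain ⟨t, ht, hE, hxt⟩ := good_commit h' (Set.mem_insert _ _)
  exact ⟨t, ht, hE, hxt⟩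

theorem main_countable {V : Type u} {G : V → V → Prop} {Y C0 A0 U0 : Set V} {𝓐 : ℕ → Set V}
    (hA : A0.Countable) (hfe : FE G Y C0 A0 U0) (hd : Disjoint A0 U0)
    (hinf : ∀ i, (U0 ∩ 𝓐 i).Infinite) :
    ∃ K, A0 ⊆ K ∧ K ⊆ A0 ∪ U0 ∧ Jn G Y C0 K ∧ ∀ i, (K ∩ 𝓐 i).Nonempty := by
  classical
  obtain ⟨v0, -⟩ := (hinf 0).nonempty
  obtain ⟨e, he⟩ : ∃ e : ℕ → V, A0 ⊆ Set.range e := by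
    haveI : Nonempty V := ⟨v0⟩
    exact Set.countable_iff_exists_subset_range.1 hA
  have hstep : ∀ (s : St V) (n : ℕ), ∃ t, Good G Y C0 A0 U0 𝓐 s → Good G Y C0 A0 U0 𝓐 t ∧ StExt s t ∧
      (e n ∈ A0 → e n ∈ t.K) ∧ (t.K ∩ 𝓐 n).Nonempty := by
    intro s n
    by_cases hs : Good G Y C0 A0 U0 𝓐 s
    · obtain ⟨u, hu, hun⟩ := (hs.inf n).nonempty
      obtain ⟨t, ht, hst, hut⟩ := good_add hs hu
      by_cases hen : e n ∈ t.A
      · obtain ⟨t', ht', htt', hk⟩ := good_commit ht hen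
        exact ⟨t', fun _ => ⟨ht', hst.trans htt', fun _ => hk, u, htt'.1 hut, hun⟩⟩
      · refine ⟨t, fun _ => ⟨ht, hst, fun h1 => ?_, u, hut, hun⟩⟩
        rcases ht.cov h1 with h2 | h2
        · exact h2
        · exact absurd h2 hen
    · exact ⟨s, fun h => absurd h hs⟩
  choose nxt hnxt using hstep
  let s0 : St V := ⟨∅, fun a _ => a, fun _ => 0, C0, A0, U0⟩
  have hs0 : Good G Y C0 A0 U0 𝓐 s0 := by
    refine ⟨?_, ?_, subset_rfl, hfe, hd, ?_, Set.subset_union_left, subset_rfl, ?_, hinf⟩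
    · constructor <;> simp [s0]
    · simp [s0]
    · simp [s0]
    · simp [s0]
  let sq : ℕ → St V := fun n => Nat.rec s0 (fun n s => nxt s n) n
  have hsq : ∀ n, sq (n+1) = nxt (sq n) n := fun n => rfl
  have hgood : ∀ n, Good G Y C0 A0 U0 𝓐 (sq n) := by
    intro n
    induction n with
    | zero => exact hs0
    | succ n ih => rw [hsq]; exact (hnxt _ n ih).1
  have hext : ∀ n k, StExt (sq n) (sq (n + k)) := by
    intro n k
    induction k with
    | zero => exact StExt.refl _
    | succ k ih =>
      refine ih.trans ?_
      rw [← add_assoc, hsq]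
      exact (hnxt _ _ (hgood _)).2.1
  have hext' : ∀ n n', n ≤ n' → StExt (sq n) (sq n') := by
    intro n n' h
    obtain ⟨k, rfl⟩ := Nat.exists_eq_add_of_le h
    exact hext n k
  let K : Set V := ⋃ n, (sq n).K
  have hK : ∀ a, a ∈ K → ∃ n, a ∈ (sq n).K := fun a ha => Set.mem_iUnion.1 ha
  choose! st hst using hK
  let p : V → ℕ → V := fun a => (sq (st a)).p a
  let l : V → ℕ := fun a => (sq (st a)).l a
  have hpl : ∀ a ∈ K, ∀ n, st a ≤ n → a ∈ (sq n).K ∧ (sq n).p a = p a ∧ (sq n).l a = l a := by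
    intro a ha n hn
    have := hext' _ _ hn
    exact ⟨this.1 (hst a ha), this.2 a (hst a ha)⟩
  refine ⟨K, ?_, ?_, ⟨p, l, ?_⟩, ?_⟩
  · intro a ha
    obtain ⟨n, rfl⟩ := he ha
    refine Set.mem_iUnion.2 ⟨n+1, ?_⟩
    rw [hsq]
    exact (hnxt _ n (hgood n)).2.2.1 ha
  · exact Set.iUnion_subset fun n => (hgood n).ksub
  · constructor
    · exact fun a ha => (hgood (st a)).lk.start a (hst a ha)
    · exact fun a ha => (hgood (st a)).lk.edge a (hst a ha)
    · exact fun a ha => (hgood (st a)).lk.fin a (hst a ha)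
    · exact fun a ha => (hgood (st a)).lk.trunc a (hst a ha)
    · exact fun a ha => (hgood (st a)).lk.mem a (hst a ha)
    · intro a ha b hb
      obtain ⟨a1, a2, a3⟩ := hpl a ha (max (st a) (st b)) (le_max_left _ _)
      obtain ⟨b1, b2, b3⟩ := hpl b hb (max (st a) (st b)) (le_max_right _ _)
      have := (hgood (max (st a) (st b))).lk.inj a a1 b b1
      rwa [a2, a3, b2, b3] at this
  · intro n
    obtain ⟨v, h1, h2⟩ := (hnxt _ n (hgood n)).2.2.2
    exact ⟨v, Set.mem_iUnion.2 ⟨n+1, h1⟩, h2⟩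

theorem main_general {V : Type u} {G : V → V → Prop} {Y C A U : Set V} {𝓐 : ℕ → Set V}
    (hU : U.Countable) (hfe : FE G Y C A U) (hd : Disjoint A U)
    (hinf : ∀ i, (U ∩ 𝓐 i).Infinite) :
    ∃ K, A ⊆ K ∧ K ⊆ A ∪ U ∧ Jn G Y C K ∧ ∀ i, (K ∩ 𝓐 i).Nonempty := by
  classical
  haveI : Countable U := hU.to_subtype
  have hfe' : ∀ F : Finset U, ∃ p l, Lk_s10 G Y C (A ∪ ((F.map (Function.Embedding.subtype _) : Finset V) : Set V)) p l := by
    intro F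
    refine hfe _ ?_
    intro v hv
    simp at hv
    exact hv.1
  choose p l hp using hfe'
  let nb : Finset U → Set V → Set V := fun F => fun S =>
    ⋃ a ∈ {a | a ∈ (A ∪ ((F.map (Function.Embedding.subtype _) : Finset V) : Set V)) ∧ ∃ i ≤ l F a, p F a i ∈ S},
      ((p F a) '' Set.Iic (l F a))
  let CC : ℕ → Set V := fun n => Nat.rec U (fun _ S => S ∪ ⋃ F, nb F S) n
  have hCC : ∀ n, CC (n+1) = CC n ∪ ⋃ F, nb F (CC n) := fun n => rfl
  have CCc : ∀ n, (CC n).Countable := by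
    intro n
    induction n with
    | zero => exact hU
    | succ n ih =>
      rw [hCC]
      refine ih.union (Set.countable_iUnion fun F => Set.Countable.biUnion ?_ fun a _ => 
        (Set.to_countable _).image _)
      have : ∀ a ∈ {a | a ∈ (A ∪ ((F.map (Function.Embedding.subtype _) : Finset V) : Set V)) ∧ ∃ i ≤ l F a, p F a i ∈ CC n}, ∃ v ∈ CC n, ∃ i ≤ l F a, p F a i = v := by
        rintro a ⟨_, i, hi, h⟩
        exact ⟨_, h, i, hi, rfl⟩
      choose! g hg i hi hgi using this
      refine Set.MapsTo.countable_of_injOn (f := g) hg ?_ ih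
      intro a ha b hb hab
      exact ((hp F).inj a ha.1 b hb.1 _ (hi a ha) _ (hi b hb)
          ((hgi a ha).trans (hab.trans (hgi b hb).symm))).1
  let W : Set V := ⋃ n, CC n
  have hW : W.Countable := Set.countable_iUnion CCc
  have hUW : U ⊆ W := fun v hv => Set.mem_iUnion.2 ⟨0, hv⟩
  have hcl : ∀ F, ∀ a ∈ (A ∪ ((F.map (Function.Embedding.subtype _) : Finset V) : Set V)),
      ∀ i ≤ l F a, p F a i ∈ W → ∀ j ≤ l F a, p F a j ∈ W := by
    intro F a ha i hi h j hj
    obtain ⟨n, hn⟩ := Set.mem_iUnion.1 h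
    refine Set.mem_iUnion.2 ⟨n+1, ?_⟩
    rw [hCC]
    refine Or.inr (Set.mem_iUnion.2 ⟨F, Set.mem_iUnion₂.2 ⟨a, ⟨ha, i, hi, hn⟩, j, hj, rfl⟩⟩)
  have hfeW : FE G Y (C ∩ W) (A ∩ W) U := by
    intro F hF
    let F' : Finset U := F.subtype (· ∈ U)
    have hF' : ((F'.map (Function.Embedding.subtype _) : Finset V) : Set V) = F := by
      ext v
      simp only [F', Finset.coe_map, Function.Embedding.subtype_apply, Set.mem_image, Finset.mem_coe,
        Finset.mem_subtype]
      constructor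
      · rintro ⟨x, hx, rfl⟩
        exact hx
      · intro hv
        exact ⟨⟨v, hF hv⟩, hv, rfl⟩
    have h1 := hp F'
    have h2 := hcl F'
    rw [hF'] at h1 h2
    have h3 : A ∩ W ∪ (F : Set V) ⊆ A ∪ (F : Set V) :=
      Set.union_subset_union_left _ Set.inter_subset_left
    have h4 := h1.mono h3
    refine ⟨p F', l F', ⟨h4.start, h4.edge, h4.fin, h4.trunc, ?_, h4.inj⟩⟩
    intro a ha i hi
    refine ⟨h4.mem a ha i hi, h2 a (h3 ha) 0 (Nat.zero_le _) ?_ i hi⟩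
    rw [h4.start a ha]
    rcases ha with ha | ha
    · exact ha.2
    · exact hUW (hF ha)
  obtain ⟨K, hK1, hK2, ⟨q, m, hq⟩, hK4⟩ := main_countable (hW.mono Set.inter_subset_right) hfeW
    (Set.disjoint_of_subset_left Set.inter_subset_left hd) hinf
  have hp0 := hp ∅
  have hc0 := hcl ∅
  simp only [Finset.map_empty, Finset.coe_empty, Set.union_empty] at hp0 hc0
  have hKW : K ⊆ W := fun v hv => (hK2 hv).elim (fun h => h.2) (fun h => hUW h)
  let p' : V → ℕ → V := fun a => if a ∈ W then q a else p ∅ a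
  let l' : V → ℕ := fun a => if a ∈ W then m a else l ∅ a
  have pW : ∀ a ∈ W, p' a = q a := fun a ha => if_pos ha
  have lW : ∀ a ∈ W, l' a = m a := fun a ha => if_pos ha
  have pN : ∀ a, a ∉ W → p' a = p ∅ a := fun a ha => if_neg ha
  have lN : ∀ a, a ∉ W → l' a = l ∅ a := fun a ha => if_neg ha
  have nW : ∀ a ∈ A, a ∉ W → ∀ i ≤ l ∅ a, p ∅ a i ∉ W := by
    intro a ha haW i hi h
    have := hc0 a ha i hi h 0 (Nat.zero_le _)
    rw [hp0.start a ha] at this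
    exact haW this
  refine ⟨K ∪ (A \ W), ?_, ?_, ⟨p', l', ?_⟩, ?_⟩
  · intro a ha
    by_cases h : a ∈ W
    · exact Or.inl (hK1 ⟨ha, h⟩)
    · exact Or.inr ⟨ha, h⟩
  · rintro a (ha | ha)
    · exact (hK2 ha).elim (fun h => Or.inl h.1) (fun h => Or.inr h)
    · exact Or.inl ha.1
  · constructor
    · rintro a (ha | ha)
      · rw [pW a (hKW ha)]; exact hq.start a ha
      · rw [pN a ha.2]; exact hp0.start a ha.1
    · rintro a (ha | ha)
      · rw [pW a (hKW ha), lW a (hKW ha)]; exact hq.edge a ha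
      · rw [pN a ha.2, lN a ha.2]; exact hp0.edge a ha.1
    · rintro a (ha | ha)
      · rw [pW a (hKW ha), lW a (hKW ha)]; exact hq.fin a ha
      · rw [pN a ha.2, lN a ha.2]; exact hp0.fin a ha.1
    · rintro a (ha | ha)
      · rw [pW a (hKW ha), lW a (hKW ha)]; exact hq.trunc a ha
      · rw [pN a ha.2, lN a ha.2]; exact hp0.trunc a ha.1
    · rintro a (ha | ha)
      · rw [pW a (hKW ha), lW a (hKW ha)]; exact fun i hi => (hq.mem a ha i hi).1
      · rw [pN a ha.2, lN a ha.2]; exact hp0.mem a ha.1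
    · rintro a (ha | ha) b (hb | hb)
      · rw [pW a (hKW ha), lW a (hKW ha), pW b (hKW hb), lW b (hKW hb)]
        exact hq.inj a ha b hb
      · rw [pW a (hKW ha), lW a (hKW ha), pN b hb.2, lN b hb.2]
        intro i hi j hj he
        exact absurd (he ▸ (hq.mem a ha i hi).2) (nW b hb.1 hb.2 j hj)
      · rw [pN a ha.2, lN a ha.2, pW b (hKW hb), lW b (hKW hb)]
        intro i hi j hj he
        exact absurd (he ▸ (hq.mem b hb j hj).2) (nW a ha.1 ha.2 i hi)
      · rw [pN a ha.2, lN a ha.2, pN b hb.2, lN b hb.2]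
        exact hp0.inj a ha.1 b hb.1
  · intro i
    obtain ⟨v, h1, h2⟩ := hK4 i
    exact ⟨v, Or.inl h1, h2⟩

theorem lastEdge_data {V : Type u} {E : Set (V × V)} (d : Dipath E) {e : V × V}
    (he : d.lastEdge? = some e) :
    ∃ n, d.verts.length = n + 2 ∧ d.verts[n]? = some e.1 ∧ d.verts[n+1]? = some e.2 := by
  unfold Dipath.lastEdge? Dipath.edges at he
  rw [List.getLast?_eq_getElem?, List.getElem?_zip_eq_some] at he
  have hl : d.verts.length = d.rest.length + 1 := by simp [Dipath.verts]
  have hz : (d.verts.zip d.rest).length = d.rest.length := by simp [hl]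
  rw [hz] at he
  obtain ⟨h1, h2⟩ := he
  have h3 : d.rest.length - 1 < d.rest.length := by
    by_contra h
    rw [List.getElem?_eq_none (by omega)] at h2
    cases h2
  refine ⟨d.rest.length - 1, by omega, h1, ?_⟩
  rw [← h2]
  simp [Dipath.verts]

theorem verts_edge {V : Type u} {E : Set (V × V)} (d : Dipath E) (i : ℕ) (a b : V)
    (ha : d.verts[i]? = some a) (hb : d.verts[i+1]? = some b) : (a, b) ∈ E := by
  have h : List.IsChain (fun a b => (a, b) ∈ E) d.verts := d.chain
  rw [List.isChain_iff_getElem] at h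
  obtain ⟨h1, rfl⟩ := List.getElem?_eq_some_iff.1 ha
  obtain ⟨h2, rfl⟩ := List.getElem?_eq_some_iff.1 hb
  exact h i h2

theorem verts_inj {V : Type u} {E : Set (V × V)} (d : Dipath E) (i j : ℕ) (a : V)
    (ha : d.verts[i]? = some a) (hb : d.verts[j]? = some a) : i = j := by
  have h : d.verts.Nodup := d.nodup
  obtain ⟨h1, h3⟩ := List.getElem?_eq_some_iff.1 ha
  obtain ⟨h2, h4⟩ := List.getElem?_eq_some_iff.1 hb
  exact (h.getElem_inj_iff).1 (h3.trans h4.symm)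

theorem verts_last {V : Type u} {E : Set (V × V)} (d : Dipath E) (n : ℕ)
    (h : d.verts.length = n + 1) : d.verts[n]? = some d.last := by
  have h' : (d.start :: d.rest).length = n + 1 := h
  show (d.start :: d.rest)[n]? = some ((d.start :: d.rest).getLast (List.cons_ne_nil _ _))
  rw [List.getLast_eq_getElem, List.getElem?_eq_some_iff]
  refine ⟨by omega, ?_⟩
  congr 1
  omega

theorem lastEdge_in {V : Type u} {E : Set (V × V)} (d : Dipath E) {e : V × V}
    (he : d.lastEdge? = some e) : e ∈ E ∧ e.2 = d.last := by
  obtain ⟨n, h1, h2, h3⟩ := lastEdge_data d he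
  refine ⟨verts_edge d n e.1 e.2 h2 h3, ?_⟩
  have := verts_last d (n+1) h1
  rw [h3] at this
  exact Option.some.inj this

theorem path_data {V : Type u} {E : Set (V × V)} {r w v : V} (d : Dipath E) (hs : d.start = r)
    (hl : d.last = w) (hv : d.lastEdge? = some (v, w)) (hvr : v ≠ r) :
    ∃ (π : ℕ → V) (k : ℕ), π 0 = v ∧ (∀ i < k, (π (i+1), π i) ∈ E) ∧ (r, π k) ∈ E ∧
      (∀ i < k, (r, π i) ∉ E) ∧ (∀ i ≤ k, π i ∈ d.support ∧ π i ≠ r ∧ π i ≠ w) ∧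
      ∀ i ≤ k, ∀ j ≤ k, π i = π j → i = j := by
  classical
  obtain ⟨n, h1, h2, h3⟩ := lastEdge_data d hv
  have h0 : d.verts[0]? = some r := by simp [Dipath.verts, hs]
  have hn : n ≠ 0 := by
    rintro rfl
    rw [h0] at h2
    exact hvr (Option.some.inj h2).symm
  have hg : ∀ i < n + 2, d.verts[i]? = some (d.verts.getD i r) := by
    intro i hi
    rw [List.getD_eq_getElem?_getD, List.getElem?_eq_getElem (by omega)]
    rfl
  let π : ℕ → V := fun i => d.verts.getD (n - i) r
  have hex : ∃ i, i ≤ n - 1 ∧ (r, π i) ∈ E := by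
    refine ⟨n - 1, le_rfl, ?_⟩
    have h4 : n - (n - 1) = 0 + 1 := by omega
    simp only [π, h4]
    exact verts_edge d 0 _ _ h0 (hg (0+1) (by omega))
  have hk := Nat.find_spec hex
  have hmin : ∀ i < Nat.find hex, ¬ (i ≤ n - 1 ∧ (r, π i) ∈ E) := fun i hi => Nat.find_min hex hi
  generalize Nat.find hex = k at hk hmin
  obtain ⟨hk1, hk2⟩ := hk
  refine ⟨π, k, ?_, ?_, hk2, ?_, ?_, ?_⟩
  · have := hg n (by omega)
    rw [h2] at this
    exact (Option.some.inj this).symm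
  · intro i hi
    refine verts_edge d (n - (i+1)) _ _ (hg _ (by omega)) ?_
    have h4 : n - (i+1) + 1 = n - i := by omega
    rw [h4]
    exact hg _ (by omega)
  · intro i hi h
    exact hmin i hi ⟨by omega, h⟩
  · intro i hi
    have h4 := hg (n - i) (by omega)
    refine ⟨List.mem_of_getElem? h4, ?_, ?_⟩
    · intro he
      have : d.verts[n-i]? = some r := by rw [h4]; exact congrArg some he
      have := verts_inj d _ _ _ this h0
      omega
    · intro he
      have : d.verts[n-i]? = some w := by rw [h4]; exact congrArg some he
      have := verts_inj d _ _ _ this h3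
      omega
  · intro i hi j hj he
    have h4 := hg (n - i) (by omega)
    have h5 := hg (n - j) (by omega)
    have h6 : d.verts.getD (n - i) r = d.verts.getD (n - j) r := he
    rw [← h6] at h5
    have := verts_inj d _ _ _ h4 h5
    omega

theorem gset_jn {V : Type u} {E : Set (V × V)} {r w : V} {J : Set (V × V)}
    (hJ : J ∈ GSet E r w) :
    Jn (fun u v => (v, u) ∈ E) {y | (r, y) ∈ E} {v | v ≠ r ∧ v ≠ w} {v | (v, w) ∈ J ∧ v ≠ r} := by
  classical
  obtain ⟨P, ⟨hP1, hP2⟩, rfl⟩ := hJ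
  have : ∀ v : V, v ∈ {v | (v, w) ∈ termEdges P ∧ v ≠ r} → ∃ (d : Dipath E) (π : ℕ → V) (k : ℕ), 
      d ∈ P ∧ d.lastEdge? = some (v, w) ∧ π 0 = v ∧ (∀ i < k, (π (i+1), π i) ∈ E) ∧ (r, π k) ∈ E ∧
      (∀ i < k, (r, π i) ∉ E) ∧ (∀ i ≤ k, π i ∈ d.support ∧ π i ≠ r ∧ π i ≠ w) ∧
      ∀ i ≤ k, ∀ j ≤ k, π i = π j → i = j := by
    rintro v ⟨⟨d, hd, he⟩, hvr⟩
    obtain ⟨π, k, h⟩ := path_data d (hP1 d hd).1 (hP1 d hd).2 he hvr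
    exact ⟨d, π, k, hd, he, h⟩
  by_cases hne : Nonempty (Dipath E)
  · choose! d π k hd he h0 h1 h2 h3 h4 h5 using this
    refine ⟨π, k, ⟨h0, h1, h2, h3, fun a ha i hi => (h4 a ha i hi).2, ?_⟩⟩
    intro a ha b hb i hi j hj hab
    have hdd : d a = d b := by
      by_contra hne
      have := hP2 (hd a ha) (hd b hb) hne ⟨(h4 a ha i hi).1, hab ▸ (h4 b hb j hj).1⟩
      rcases this with h | h
      · exact (h4 a ha i hi).2.1 h
      · exact (h4 a ha i hi).2.2 h
    have hab' : a = b := by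
      have h6 := he a ha
      rw [hdd, he b hb] at h6
      exact (congrArg Prod.fst (Option.some.inj h6)).symm
    subst hab'
    exact ⟨rfl, h5 a ha i hi j hj hab⟩
  · refine ⟨fun a _ => a, fun _ => 0, ?_⟩
    have hem : {v | (v, w) ∈ termEdges P ∧ v ≠ r} = ∅ := by
      ext v
      simp only [Set.mem_setOf_eq, Set.mem_empty_iff_false, iff_false]
      rintro ⟨⟨d, -⟩, -⟩
      exact hne ⟨d⟩
    rw [hem]
    constructor <;> simp

theorem path_build {V : Type u} {E : Set (V × V)} {r w : V} (hwr : w ≠ r) (π : ℕ → V) (k : ℕ)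
    (h1 : ∀ i < k, (π (i+1), π i) ∈ E) (h2 : (r, π k) ∈ E) (h3 : (π 0, w) ∈ E)
    (h4 : ∀ i ≤ k, π i ≠ r ∧ π i ≠ w) (h5 : ∀ i ≤ k, ∀ j ≤ k, π i = π j → i = j) :
    ∃ d : Dipath E, d.start = r ∧ d.last = w ∧ d.lastEdge? = some (π 0, w) ∧
      ∀ v ∈ d.support, v = r ∨ v = w ∨ ∃ i ≤ k, v = π i := by
  classical
  let g : Fin (k+2) → V := fun i => if (i : ℕ) ≤ k then π (k - i) else w
  have gle : ∀ (i : ℕ) (hi : i < k + 2), i ≤ k → g ⟨i, hi⟩ = π (k - i) := fun i hi h => if_pos h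
  have gw : ∀ (hi : k + 1 < k + 2), g ⟨k+1, hi⟩ = w := fun hi => if_neg (by simp)
  refine ⟨⟨r, List.ofFn g, ?_, ?_⟩, rfl, ?_, ?_, ?_⟩
  · show List.IsChain _ (r :: List.ofFn g)
    rw [List.isChain_iff_getElem]
    intro i hi
    simp only [List.length_cons, List.length_ofFn] at hi
    cases i with
    | zero =>
      simp only [List.getElem_cons_zero, List.getElem_cons_succ, List.getElem_ofFn]
      rw [gle 0 (by omega) (by omega)]
      exact h2
    | succ i =>
      simp only [List.getElem_cons_succ, List.getElem_ofFn]
      rw [gle i (by omega) (by omega)]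
      by_cases hik : i + 1 ≤ k
      · rw [gle (i+1) (by omega) hik]
        have := h1 (k - (i+1)) (by omega)
        have e : k - (i+1) + 1 = k - i := by omega
        rwa [e] at this
      · obtain rfl : i = k := by omega
        rw [gw]
        simpa using h3
  · rw [List.nodup_cons, List.nodup_ofFn]
    constructor
    · rw [List.mem_ofFn]
      rintro ⟨⟨i, hi⟩, he⟩
      by_cases hik : i ≤ k
      · rw [gle i hi hik] at he
        exact (h4 _ (by omega)).1 he
      · obtain rfl : i = k + 1 := by omega
        rw [gw] at he
        exact hwr he
    · rintro ⟨i, hi⟩ ⟨j, hj⟩ he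
      by_cases hik : i ≤ k
      · by_cases hjk : j ≤ k
        · rw [gle i hi hik, gle j hj hjk] at he
          have := h5 _ (by omega) _ (by omega) he
          exact Fin.ext (by simp; omega)
        · obtain rfl : j = k + 1 := by omega
          rw [gle i hi hik, gw] at he
          exact absurd he (h4 _ (by omega)).2
      · obtain rfl : i = k + 1 := by omega
        by_cases hjk : j ≤ k
        · rw [gle j hj hjk, gw] at he
          exact absurd he.symm (h4 _ (by omega)).2
        · exact Fin.ext (by simp; omega)
  · apply Option.some.inj
    rw [← verts_last _ (k + 2) (by simp [Dipath.verts])]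
    show (r :: List.ofFn g)[k + 1 + 1]? = some w
    rw [List.getElem?_cons_succ, List.getElem?_eq_some_iff]
    exact ⟨by simp, by rw [List.getElem_ofFn]; exact gw _⟩
  · unfold Dipath.lastEdge? Dipath.edges Dipath.verts
    rw [List.getLast?_eq_getElem?, List.getElem?_zip_eq_some]
    have hidx : ((r :: List.ofFn g).zip (List.ofFn g)).length - 1 = k + 1 := by
      rw [List.length_zip, List.length_cons, List.length_ofFn]
      omega
    show (r :: List.ofFn g)[((r :: List.ofFn g).zip (List.ofFn g)).length - 1]? = some (π 0) ∧
      (List.ofFn g)[((r :: List.ofFn g).zip (List.ofFn g)).length - 1]? = some w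
    rw [hidx, List.getElem?_cons_succ, List.getElem?_eq_some_iff, List.getElem?_eq_some_iff]
    refine ⟨⟨by rw [List.length_ofFn]; omega, ?_⟩, ⟨by rw [List.length_ofFn]; omega, ?_⟩⟩
    · rw [List.getElem_ofFn, gle k (by omega) le_rfl, Nat.sub_self]
    · rw [List.getElem_ofFn]
      exact gw _
  · intro v hv
    rcases List.mem_cons.1 hv with h | h
    · exact Or.inl h
    · rw [List.mem_ofFn] at h
      obtain ⟨⟨i, hi⟩, rfl⟩ := h
      by_cases hik : i ≤ k
      · exact Or.inr (Or.inr ⟨k - i, by omega, gle i hi hik⟩)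
      · obtain rfl : i = k + 1 := by omega
        exact Or.inr (Or.inl (gw _))

theorem jn_gset {V : Type u} {E : Set (V × V)} {r w : V} (hwr : w ≠ r) {K : Set V}
    (hK : Jn (fun u v => (v, u) ∈ E) {y | (r, y) ∈ E} {v | v ≠ r ∧ v ≠ w} K)
    (hin : ∀ v ∈ K, (v, w) ∈ E) (I1 : Set (V × V)) (hI1 : I1 ⊆ {(r, w)}) (hI1E : I1 ⊆ E) :
    {e | e.1 ∈ K ∧ e.2 = w} ∪ I1 ∈ GSet E r w := by
  classical
  obtain ⟨p, l, hp⟩ := hK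
  have : ∀ a ∈ K, ∃ d : Dipath E, d.start = r ∧ d.last = w ∧ d.lastEdge? = some (a, w) ∧
      ∀ v ∈ d.support, v = r ∨ v = w ∨ ∃ i ≤ l a, v = p a i := by
    intro a ha
    have := path_build hwr (p a) (l a) (hp.edge a ha) (hp.fin a ha)
      (by rw [hp.start a ha]; exact hin a ha) (hp.mem a ha)
      (fun i hi j hj he => (hp.inj a ha a ha i hi j hj he).2)
    rwa [hp.start a ha] at this
  let P0 : Set (Dipath E) := {d | d.start = r ∧ d.last = w ∧ ∃ e ∈ I1, d.lastEdge? = some e ∧ d.rest = [w]}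
  have hP0s : ∀ d ∈ P0, ∀ v ∈ d.support, v = r ∨ v = w := by
    rintro d ⟨h1, h2, e, he, h3, h4⟩ v hv
    have : v ∈ d.start :: d.rest := hv
    rw [h1, h4] at this
    simpa using this
  have hP0e : termEdges P0 = I1 := by
    ext e
    constructor
    · rintro ⟨d, ⟨h1, h2, e', he', h3, h4⟩, h⟩
      rw [h3] at h
      exact (Option.some.inj h) ▸ he'
    · intro he
      obtain rfl : e = (r, w) := hI1 he
      refine ⟨⟨r, [w], ?_, ?_⟩, ⟨rfl, rfl, (r, w), he, rfl, rfl⟩, rfl⟩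
      · show List.IsChain _ [r, w]
        simpa using hI1E he
      · simpa using hwr.symm
  choose! d hd1 hd2 hd3 hd4 using fun (a : K) => this a.1 a.2
  refine ⟨Set.range d ∪ P0, ⟨?_, ?_⟩, ?_⟩
  · rintro x (⟨a, rfl⟩ | hx)
    · exact ⟨hd1 a, hd2 a⟩
    · exact ⟨hx.1, hx.2.1⟩
  · rintro x (⟨a, rfl⟩ | hx) y (⟨b, rfl⟩ | hy) hne v ⟨hvx, hvy⟩
    · rcases hd4 a v hvx with h | h | ⟨i, hi, h⟩
      · exact Or.inl h
      · exact Or.inr h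
      · rcases hd4 b v hvy with h' | h' | ⟨j, hj, h'⟩
        · exact Or.inl h'
        · exact Or.inr h'
        · have := (hp.inj a a.2 b b.2 i hi j hj (h.symm.trans h')).1
          exact absurd (congrArg d (Subtype.ext this)) hne
    · exact hP0s y hy v hvy
    · exact hP0s x hx v hvx
    · exact hP0s x hx v hvx
  · rw [← hP0e]
    ext e
    constructor
    · rintro ⟨x, (⟨a, rfl⟩ | hx), he⟩
      · rw [hd3] at he
        obtain rfl := Option.some.inj he
        exact Or.inl ⟨a.2, rfl⟩
      · exact Or.inr ⟨x, hx, he⟩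
    · rintro (⟨h1, h2⟩ | ⟨x, hx, he⟩)
      · refine ⟨d ⟨e.1, h1⟩, Or.inl ⟨_, rfl⟩, ?_⟩
        rw [hd3, ← h2]
      · exact ⟨x, Or.inr hx, he⟩

/-- If `I ∈ 𝒢_D(w)` and every finite extension of `I` inside `in_D(w)` lies in
`𝒢_D(w)`, then for every countable family of infinite subsets of `in_D(w) \ I`
there is an `I₀ ∈ 𝒢_D(w)` extending `I` and meeting each member of the family. -/
theorem stmt10 {V : Type u} (E : Set (V × V)) (r w : V) (hw : w ≠ r)
    (I : Set (V × V)) (hI : I ∈ GSet E r w)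
    (hext : ∀ J, I ⊆ J → J ⊆ inEdges E w → (J \ I).Finite → J ∈ GSet E r w)
    (𝓘 : ℕ → Set (V × V))
    (h𝓘 : ∀ i, 𝓘 i ⊆ inEdges E w \ I ∧ (𝓘 i).Infinite) :
    ∃ I₀ ∈ GSet E r w, I ⊆ I₀ ∧ ∀ i, (I₀ ∩ 𝓘 i).Nonempty := by
  classical
  have hIin : I ⊆ inEdges E w := by
    obtain ⟨P, ⟨hP1, -⟩, rfl⟩ := hI
    rintro e ⟨d, hd, he⟩
    have := lastEdge_in d he
    exact ⟨this.1, this.2.trans (hP1 d hd).2⟩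
  let A : Set V := {v | (v, w) ∈ I ∧ v ≠ r}
  let 𝓐 : ℕ → Set V := fun i => {v | (v, w) ∈ 𝓘 i ∧ v ≠ r}
  have hinf : ∀ i, (𝓐 i).Infinite := by
    intro i hfin
    refine (h𝓘 i).2 (((hfin.insert r).image (fun v => (v, w))).subset ?_)
    rintro ⟨v, y⟩ he
    obtain rfl : y = w := ((h𝓘 i).1 he).1.2
    by_cases hvr : v = r
    · exact ⟨v, Or.inl hvr, rfl⟩
    · exact ⟨v, Or.inr ⟨he, hvr⟩, rfl⟩
  let U : Set V := ⋃ i, Set.range (fun n => ((hinf i).natEmbedding _ n : V))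
  have hU : U.Countable := Set.countable_iUnion fun i => Set.countable_range _
  have hUsub : ∀ v ∈ U, v ≠ r ∧ (v, w) ∈ inEdges E w ∧ (v, w) ∉ I := by
    intro v hv
    obtain ⟨i, n, rfl⟩ := Set.mem_iUnion.1 hv
    have h := ((hinf i).natEmbedding _ n).2
    exact ⟨h.2, ((h𝓘 i).1 h.1).1, ((h𝓘 i).1 h.1).2⟩
  have hUinf : ∀ i, (U ∩ 𝓐 i).Infinite := by
    intro i
    have : (Set.range (fun n => ((hinf i).natEmbedding _ n : V))).Infinite :=
      Set.infinite_range_of_injective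
        (Subtype.val_injective.comp ((hinf i).natEmbedding _).injective)
    refine this.mono ?_
    rintro v ⟨n, rfl⟩
    exact ⟨Set.mem_iUnion.2 ⟨i, n, rfl⟩, ((hinf i).natEmbedding _ n).2⟩
  have hd : Disjoint A U := by
    rw [Set.disjoint_left]
    intro v hv hvU
    exact (hUsub v hvU).2.2 hv.1
  have hfe : FE (fun u v => (v, u) ∈ E) {y | (r, y) ∈ E} {v | v ≠ r ∧ v ≠ w} A U := by
    intro F hF
    have := gset_jn (hext (I ∪ (fun v => (v, w)) '' (F : Set V)) Set.subset_union_left ?_ ?_)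
    · refine this.mono ?_
      rintro v (hv | hv)
      · exact ⟨Or.inl hv.1, hv.2⟩
      · exact ⟨Or.inr ⟨v, hv, rfl⟩, (hUsub v (hF hv)).1⟩
    · apply Set.union_subset hIin
      rintro e ⟨v, hv, rfl⟩
      exact (hUsub v (hF hv)).2.1
    · refine (F.finite_toSet.image (fun v => (v, w))).subset ?_
      rintro e ⟨h1 | h1, h2⟩
      · exact absurd h1 h2
      · exact h1
  obtain ⟨K, hK1, hK2, hK3, hK4⟩ := main_general hU hfe hd hUinf
  refine ⟨{e | e.1 ∈ K ∧ e.2 = w} ∪ (I ∩ {(r, w)}), ?_, ?_, ?_⟩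
  · refine jn_gset hw hK3 ?_ _ Set.inter_subset_right fun e he => (hIin he.1).1
    intro v hv
    rcases hK2 hv with h | h
    · exact (hIin h.1).1
    · exact (hUsub v h).2.1.1
  · rintro ⟨v, y⟩ he
    obtain rfl : y = w := (hIin he).2
    by_cases hvr : v = r
    · subst hvr
      exact Or.inr ⟨he, rfl⟩
    · exact Or.inl ⟨hK1 ⟨he, hvr⟩, rfl⟩
  · intro i
    obtain ⟨v, h1, h2⟩ := hK4 i
    exact ⟨(v, w), Or.inl ⟨h1, rfl⟩, h2.1⟩
end
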